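/- Let P and Q be probability distributions on finite sets, neither of which is a uniform distribution, with H(P)/V(P) < H(Q)/V(Q). For b ∈ ℝ let β(b) be the unique real solution of N_P(x)/N_{P,Q,b}(x) = (1 − G_P(x))/(1 − G_{P,Q,b}(x)) and set F_2(b) := I_{P,Q,b}(β(b)) + √((1 − G_P(β(b)))·(1 − G_{P,Q,b}(β(b)))). Then for 0 < ν < 1 and any b ∈ ℝ with F_2(b) = ν, one has lim_{n→∞} (L^D_n(P,Q|ν) − (H(P)/H(Q))·n)/√n = b; in particular R^D_2(P,Q|ν) = b = F_2^{−1}(ν). -/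

import Mathlib

open MeasureTheory Filter

namespace RNG

variable {α β : Type*}

/-- `P` is a probability distribution on the finite set `α`. -/
def IsProb [Fintype α] (P : α → ℝ) : Prop :=
  (∀ x, 0 ≤ P x) ∧ ∑ x, P x = 1

open Classical in
/-- Pushforward distribution `W(P)(y) = ∑_{x : W x = y} P x`. -/
noncomputable def push [Fintype α] (W : α → β) (P : α → ℝ) : β → ℝ :=
  fun y => ∑ x, if W x = y then P x else 0

/-- Fidelity (Bhattacharyya coefficient) between distributions on the same finite set. -/
noncomputable def fid [Fintype β] (R S : β → ℝ) : ℝ :=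
  ∑ y, Real.sqrt (R y * S y)

/-- Sum of the `l` largest values of `P`, i.e. the `l`-th partial sum of the
decreasing rearrangement of `P` (padded with zeros). -/
noncomputable def topSum [Fintype α] (P : α → ℝ) (l : ℕ) : ℝ :=
  sSup {s : ℝ | ∃ A : Finset α, A.card ≤ l ∧ s = ∑ x ∈ A, P x}

/-- Majorization `P ≺ P'` (the distributions may live on different finite sets). -/
def Maj [Fintype α] [Fintype β] (P : α → ℝ) (P' : β → ℝ) : Prop :=
  ∀ l : ℕ, topSum P l ≤ topSum P' l

/-- Maximal fidelity under deterministic transformations,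
`F^D(P → Q) = max {F(W(P), Q) | W : α → β}`. -/
noncomputable def FD [Fintype α] [Fintype β] (P : α → ℝ) (Q : β → ℝ) : ℝ :=
  sSup {r : ℝ | ∃ W : α → β, r = fid (push W P) Q}

/-- Maximal fidelity under the majorization condition,
`F^M(P → Q) = max {F(P', Q) | P ≺ P', P'` a distribution on the target set`}`. -/
noncomputable def FM [Fintype α] [Fintype β] (P : α → ℝ) (Q : β → ℝ) : ℝ :=
  sSup {r : ℝ | ∃ P' : β → ℝ, IsProb P' ∧ Maj P P' ∧ r = fid P' Q}

/-- Shannon entropy (natural logarithm). -/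
noncomputable def H [Fintype α] (P : α → ℝ) : ℝ := ∑ x, -(P x * Real.log (P x))

/-- Varentropy `V(P)` (natural logarithm). -/
noncomputable def V [Fintype α] (P : α → ℝ) : ℝ :=
  ∑ x, P x * (-Real.log (P x) - H P) ^ 2

/-- Shannon entropy, base-2 logarithm. -/
noncomputable def H2 [Fintype α] (P : α → ℝ) : ℝ := ∑ x, -(P x * Real.logb 2 (P x))

/-- Varentropy, base-2 logarithm. -/
noncomputable def V2 [Fintype α] (P : α → ℝ) : ℝ :=
  ∑ x, P x * (-Real.logb 2 (P x) - H2 P) ^ 2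

/-- The `n`-fold i.i.d. product distribution `P^n`. -/
noncomputable def iid [Fintype α] (P : α → ℝ) (n : ℕ) : (Fin n → α) → ℝ :=
  fun f => ∏ i, P (f i)

/-- The uniform distribution on a two-element set. -/
noncomputable def U2 : Fin 2 → ℝ := fun _ => 1 / 2

/-- Density of the normal distribution `N(m, v)`. -/
noncomputable def normalPDF (m v t : ℝ) : ℝ :=
  (Real.sqrt (2 * Real.pi * v))⁻¹ * Real.exp (-(t - m) ^ 2 / (2 * v))

/-- Standard normal cumulative distribution function `G`. -/
noncomputable def stdG (x : ℝ) : ℝ := ∫ t in Set.Iic x, normalPDF 0 1 t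

/-- Density `N_P` of `N(0, V(P))`. -/
noncomputable def NP [Fintype α] (P : α → ℝ) (x : ℝ) : ℝ := normalPDF 0 (V P) x

/-- Density `N_{P,Q,b}` of `N(H(Q)b, (H(P)/H(Q))·V(Q))`. -/
noncomputable def NPQ [Fintype α] [Fintype β] (P : α → ℝ) (Q : β → ℝ) (b x : ℝ) : ℝ :=
  normalPDF (H Q * b) (H P / H Q * V Q) x

/-- Cdf `G_P(x) = G(x/√V(P))`. -/
noncomputable def GP [Fintype α] (P : α → ℝ) (x : ℝ) : ℝ := stdG (x / Real.sqrt (V P))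

/-- Cdf `G_{P,Q,b}(x) = G(√(H(Q)/(H(P)V(Q)))·(x − H(Q)b))`. -/
noncomputable def GPQ [Fintype α] [Fintype β] (P : α → ℝ) (Q : β → ℝ) (b x : ℝ) : ℝ :=
  stdG (Real.sqrt (H Q / (H P * V Q)) * (x - H Q * b))

/-- `I_{P,Q,b}(x) = ∫_{−∞}^x √(N_P(t) N_{P,Q,b}(t)) dt`. -/
noncomputable def IPQ [Fintype α] [Fintype β] (P : α → ℝ) (Q : β → ℝ) (b x : ℝ) : ℝ :=
  ∫ t in Set.Iic x, Real.sqrt (NP P t * NPQ P Q b t)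

/-- `I_{P,Q,b}(∞) = ∫_ℝ √(N_P(t) N_{P,Q,b}(t)) dt`. -/
noncomputable def IPQinf [Fintype α] [Fintype β] (P : α → ℝ) (Q : β → ℝ) (b : ℝ) : ℝ :=
  ∫ t : ℝ, Real.sqrt (NP P t * NPQ P Q b t)

/-- `L^D_n(P,Q|ν)`: the maximal `L` with `F^D(P^n → Q^L) ≥ ν`. -/
noncomputable def LD [Fintype α] [Fintype β] (P : α → ℝ) (Q : β → ℝ) (ν : ℝ) (n : ℕ) : ℕ :=
  sSup {L : ℕ | ν ≤ FD (iid P n) (iid Q L)}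

/-- The optimal second order rate `R^D_2(P,Q|ν)`. -/
noncomputable def RD2 [Fintype α] [Fintype β] (P : α → ℝ) (Q : β → ℝ) (ν : ℝ) : ℝ :=
  sSup {b : ℝ | ∃ c : ℝ, ν ≤ c ∧
    Tendsto (fun n : ℕ =>
      FD (iid P n) (iid Q (⌊H P / H Q * n + b * Real.sqrt n⌋₊))) atTop (nhds c)}

lemma sqrt_add_le_add_sqrt' {a b : ℝ} (ha : 0 ≤ a) (hb : 0 ≤ b) :
    √(a + b) ≤ √a + √b := by
  rw [Real.sqrt_le_left (by positivity)]
  nlinarith [Real.sq_sqrt ha, Real.sq_sqrt hb, Real.sqrt_nonneg a, Real.sqrt_nonneg b,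
    mul_nonneg (Real.sqrt_nonneg a) (Real.sqrt_nonneg b)]

lemma sqrt_mul_le_half_add {a b : ℝ} (ha : 0 ≤ a) (hb : 0 ≤ b) : √(a * b) ≤ (a + b) / 2 := by
  rw [Real.sqrt_le_left (by positivity)]
  nlinarith [sq_nonneg (a - b)]

lemma push_nonneg [Fintype α] (W : α → β) {f : α → ℝ} (hf : ∀ x, 0 ≤ f x) (y : β) : 0 ≤ push W f y := by
  classical
  exact Finset.sum_nonneg fun x _ => by split_ifs <;> simp [hf]

/-- From atoms of size at most `m` one can select a subset whose mass lies in `[T - m, T]`. -/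
lemma exists_subset_sum_mem {P : α → ℝ} {m T : ℝ} (hT : 0 ≤ T) (U : Finset α)
    (hm : ∀ x ∈ U, P x ≤ m) (hU : T ≤ ∑ x ∈ U, P x + m) :
    ∃ S ⊆ U, T ≤ ∑ x ∈ S, P x + m ∧ ∑ x ∈ S, P x ≤ T := by
  classical
  induction U using Finset.induction_on with
  | empty => exact ⟨∅, subset_rfl, hU, by simpa using hT⟩
  | insert a U ha ih =>
    by_cases h : ∑ x ∈ insert a U, P x ≤ T
    · exact ⟨_, subset_rfl, hU, h⟩
    · rw [Finset.sum_insert ha] at h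
      have := hm a (Finset.mem_insert_self _ _)
      obtain ⟨S, hS, h1⟩ := ih (fun x hx => hm x (Finset.mem_insert_of_mem hx)) (by linarith)
      exact ⟨S, hS.trans (Finset.subset_insert _ _), h1⟩

section OneShot
variable [Fintype α] [Fintype β]

lemma sum_push_mul (W : α → β) (f : α → ℝ) (h : β → ℝ) :
    ∑ y, push W f y * h y = ∑ x, f x * h (W x) := by
  classical
  simp only [push, Finset.sum_mul]
  rw [Finset.sum_comm]
  refine Finset.sum_congr rfl fun x _ => ?_
  rw [Finset.sum_eq_single (W x)] <;> aesop

lemma sum_push (W : α → β) (f : α → ℝ) : ∑ y, push W f y = ∑ x, f x := by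
  simpa using sum_push_mul W f 1

lemma push_comp {γ : Type*} [Fintype γ] (W : α → β) (U : β → γ) (f : α → ℝ) :
    push U (push W f) = push (U ∘ W) f := by
  classical
  funext z
  have := sum_push_mul W f (fun y => if U y = z then 1 else 0)
  simpa [push] using this

/-- Weak duality bound on the fidelity of a deterministic conversion. -/
lemma fid_push_le {P : α → ℝ} {Q : β → ℝ} (hP : IsProb P) (hQ : ∀ y, 0 ≤ Q y) (W : α → β)
    {e : ℝ} (he : 0 ≤ e) {s w : β → ℝ} {t : α → ℝ} (hs : ∀ y, 0 < s y)
    (hsw : ∀ y, s y * w y = 1) (ht : ∀ x, 0 ≤ t x)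
    (h : ∀ x, 0 < P x → e * P x < Q (W x) → s (W x) ≤ t x) :
    fid (push W P) Q ≤ √e + (∑ x, P x * t x) / 2 + (∑ y, Q y * w y) / 2 := by
  classical
  set G : α → ℝ := fun x => if e * P x < Q (W x) then P x else 0 with hG
  set B : α → ℝ := fun x => if e * P x < Q (W x) then 0 else P x with hB
  have hG0 : ∀ x, 0 ≤ G x := fun x => by simp only [hG]; split_ifs <;> simp [hP.1]
  have hB0 : ∀ x, 0 ≤ B x := fun x => by simp only [hB]; split_ifs <;> simp [hP.1]
  have hw : ∀ y, 0 < w y := fun y => by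
    have := hsw y
    exact (pos_iff_pos_of_mul_pos (by rw [this]; norm_num)).1 (hs y)
  have hPGB : ∀ y, push W P y = push W G y + push W B y := fun y => by
    simp only [push, ← Finset.sum_add_distrib, hG, hB]
    refine Finset.sum_congr rfl fun x _ => ?_
    split_ifs <;> simp
  have hgood : ∀ y, √(push W G y * Q y) ≤ (push W G y * s y + Q y * w y) / 2 := fun y => by
    have : push W G y * Q y = (push W G y * s y) * (Q y * w y) := by
      linear_combination (-(push W G y * Q y)) * hsw y
    rw [this]
    exact sqrt_mul_le_half_add (mul_nonneg (push_nonneg W hG0 y) (hs y).le)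
      (mul_nonneg (hQ y) (hw y).le)
  have hbad : ∀ y, √(push W B y * Q y) ≤ √e * push W B y := fun y => by
    have hb := push_nonneg W hB0 y
    have key : push W B y * Q y ≤ e * push W B y * push W B y := by
      conv_lhs => rw [push, Finset.sum_mul]
      conv_rhs => rw [mul_comm]
      conv_rhs => lhs; rw [push]
      rw [Finset.sum_mul]
      refine Finset.sum_le_sum fun x _ => ?_
      by_cases hx : W x = y
      · by_cases hg : e * P x < Q (W x)
        · simp [hB, hg]
        · simp only [hx, if_true]
          refine mul_le_mul_of_nonneg_left ?_ (hB0 x)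
          have h1 : B x = P x := by simp [hB, hg]
          have h2 : B x ≤ push W B y := by
            have := Finset.single_le_sum (f := fun x => if W x = y then B x else 0)
              (fun i _ => by split_ifs <;> simp [hB0]) (Finset.mem_univ x)
            simpa [push, hx] using this
          rw [not_lt, hx] at hg
          exact hg.trans (mul_le_mul_of_nonneg_left (h1 ▸ h2) he)
      · simp [hx]
    calc √(push W B y * Q y) ≤ √(e * push W B y * push W B y) := Real.sqrt_le_sqrt key
      _ = √e * push W B y := by
        rw [mul_assoc, Real.sqrt_mul he, Real.sqrt_mul_self hb]
  have hB1 : ∑ y, push W B y ≤ 1 := by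
    rw [sum_push, ← hP.2]
    exact Finset.sum_le_sum fun x _ => by
      simp only [hB]; split_ifs <;> simp [hP.1]
  have hGs : ∑ y, push W G y * s y ≤ ∑ x, P x * t x := by
    rw [sum_push_mul]
    refine Finset.sum_le_sum fun x _ => ?_
    by_cases hg : e * P x < Q (W x)
    · rcases (hP.1 x).eq_or_lt with h0 | h0
      · simp [hG, ← h0]
      · simpa [hG, hg] using mul_le_mul_of_nonneg_left (h x h0 hg) h0.le
    · simpa [hG, hg] using mul_nonneg (hP.1 x) (ht x)
  calc fid (push W P) Q
      ≤ ∑ y, ((push W G y * s y + Q y * w y) / 2 + √e * push W B y) := by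
        refine Finset.sum_le_sum fun y _ => ?_
        rw [hPGB, add_mul]
        refine (sqrt_add_le_add_sqrt' (mul_nonneg (push_nonneg W hG0 y) (hQ y))
          (mul_nonneg (push_nonneg W hB0 y) (hQ y))).trans ?_
        exact add_le_add (hgood y) (hbad y)
    _ = (∑ y, push W G y * s y) / 2 + (∑ y, Q y * w y) / 2 + √e * ∑ y, push W B y := by
        rw [Finset.sum_add_distrib, ← Finset.sum_div, Finset.sum_add_distrib, Finset.mul_sum]
        ring
    _ ≤ _ := by
        have := mul_le_mul_of_nonneg_left hB1 (Real.sqrt_nonneg e)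
        linarith

lemma fid_push_le_fid {γ : Type*} [Fintype γ] (U : β → γ) {R S : β → ℝ} (hR : ∀ y, 0 ≤ R y)
    (hS : ∀ y, 0 ≤ S y) : fid R S ≤ fid (push U R) (push U S) := by
  classical
  have : fid R S = ∑ z, push U (fun y => √(R y * S y)) z := (sum_push U _).symm
  rw [this]
  refine Finset.sum_le_sum fun z _ => ?_
  simp only [push]
  rw [← Finset.sum_filter, ← Finset.sum_filter, ← Finset.sum_filter]
  rw [Real.sqrt_mul (Finset.sum_nonneg fun y _ => hR y)]
  simp_rw [fun y => Real.sqrt_mul (hR y) (S y)]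
  exact Real.sum_sqrt_mul_sqrt_le _ hR hS

lemma finite_fid_push (P : α → ℝ) (Q : β → ℝ) : {r : ℝ | ∃ W : α → β, r = fid (push W P) Q}.Finite := by
  classical
  refine (Set.finite_range fun W : α → β => fid (push W P) Q).subset ?_
  rintro _ ⟨W, rfl⟩
  exact ⟨W, rfl⟩

lemma fid_push_le_FD (P : α → ℝ) (Q : β → ℝ) (W : α → β) : fid (push W P) Q ≤ FD P Q :=
  le_csSup (finite_fid_push P Q).bddAbove ⟨W, rfl⟩

lemma FD_le [Nonempty β] {P : α → ℝ} {Q : β → ℝ} {c : ℝ}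
    (h : ∀ W : α → β, fid (push W P) Q ≤ c) : FD P Q ≤ c := by
  refine csSup_le ⟨_, fun _ => Classical.arbitrary β, rfl⟩ ?_
  rintro _ ⟨W, rfl⟩
  exact h W

lemma exists_disjoint_fill {P : α → ℝ} (hP : ∀ x, 0 ≤ P x) {Q T : β → ℝ} {e : ℝ}
    (hT : ∀ y, 0 ≤ T y) (he : 0 ≤ e) (hQ : ∀ y, 0 ≤ Q y)
    (h : ∀ y, 0 < T y → ∑ z with Q z ≤ Q y, T z ≤ ∑ x with P x ≤ e * Q y, P x) :
    ∃ S : β → Finset α, (∀ y z, y ≠ z → Disjoint (S y) (S z)) ∧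
      ∀ y, T y ≤ ∑ x ∈ S y, P x + e * Q y := by
  classical
  suffices H : ∀ s : Finset β, ∃ S : β → Finset α, (∀ y z, y ≠ z → Disjoint (S y) (S z)) ∧
      (∀ y ∉ s, S y = ∅) ∧
      (∀ y ∈ s, T y ≤ ∑ x ∈ S y, P x + e * Q y) ∧ ∀ y ∈ s, ∑ x ∈ S y, P x ≤ T y by
    obtain ⟨S, h1, -, h2, -⟩ := H Finset.univ
    exact ⟨S, h1, fun y => h2 y (Finset.mem_univ y)⟩
  intro s
  induction s using Finset.induction_on_max_value Q with
  | empty => exact ⟨fun _ => ∅, by simp, by simp, by simp, by simp⟩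
  | insert a s ha hmax ih =>
    obtain ⟨S, hd, hem, hlow, hup⟩ := ih
    obtain ⟨A, hA, hA1, hA2⟩ : ∃ A : Finset α, (∀ y ∈ s, Disjoint A (S y)) ∧
        T a ≤ ∑ x ∈ A, P x + e * Q a ∧ ∑ x ∈ A, P x ≤ T a := by
      rcases (hT a).eq_or_lt with h0 | h0
      · exact ⟨∅, by simp, by simpa [← h0] using mul_nonneg he (hQ a), by simp [← h0]⟩
      set X := Finset.univ.filter (fun x => P x ≤ e * Q a)
      have hused : ∑ x ∈ s.biUnion S, P x ≤ ∑ y ∈ s, T y := by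
        rw [Finset.sum_biUnion fun y _ z _ hyz => hd y z hyz]
        exact Finset.sum_le_sum hup
      have htot : ∑ y ∈ s, T y + T a ≤ ∑ x ∈ X, P x := by
        refine le_trans ?_ (h a h0)
        rw [add_comm, ← Finset.sum_insert ha]
        refine Finset.sum_le_sum_of_subset_of_nonneg ?_ fun y _ _ => hT y
        intro y hy
        rcases Finset.mem_insert.1 hy with rfl | hy
        · simp
        · simpa using hmax y hy
      have hsd : ∑ x ∈ X, P x ≤ ∑ x ∈ X \ s.biUnion S, P x + ∑ x ∈ s.biUnion S, P x := by
        rw [← Finset.sum_union Finset.sdiff_disjoint]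
        refine Finset.sum_le_sum_of_subset_of_nonneg ?_ fun y _ _ => hP y
        intro x hx
        simp only [Finset.mem_union, Finset.mem_sdiff]
        tauto
      obtain ⟨A, hAX, hA⟩ := exists_subset_sum_mem (P := P) (m := e * Q a) (hT a)
        (X \ s.biUnion S) (fun x hx => by simp [X] at hx; exact hx.1)
        (by have := mul_nonneg he (hQ a); linarith)
      refine ⟨A, fun y hy => ?_, hA⟩
      refine Finset.disjoint_of_subset_left hAX ?_
      exact Finset.disjoint_of_subset_right (Finset.subset_biUnion_of_mem S hy)
        Finset.sdiff_disjoint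
    have hA' : ∀ y, y ≠ a → Disjoint A (S y) := fun y hy => by
      by_cases hs : y ∈ s
      · exact hA y hs
      · simp [hem y hs]
    refine ⟨Function.update S a A, ?_, ?_, ?_, ?_⟩
    · intro y z hyz
      by_cases hy : y = a
      · subst hy
        simpa [Function.update_of_ne hyz.symm] using hA' z hyz.symm
      · by_cases hz : z = a
        · subst hz
          simpa [Function.update_of_ne hyz] using (hA' y hyz).symm
        · simpa [hy, hz] using hd y z hyz
    · intro y hy
      simp only [Finset.mem_insert, not_or] at hy
      simpa [hy.1] using hem y hy.2
    · intro y hy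
      by_cases h' : y = a
      · subst h'; simpa using hA1
      · simpa [h'] using hlow y (by simpa [h'] using hy)
    · intro y hy
      by_cases h' : y = a
      · subst h'; simpa using hA2
      · simpa [h'] using hup y (by simpa [h'] using hy)

/-- Achievability: a target density `g` relative to `Q` whose tails are dominated by those of `P`
can be approximated by a deterministic conversion. -/
lemma le_FD [Nonempty β] {P : α → ℝ} (hP : ∀ x, 0 ≤ P x) {Q : β → ℝ} (hQ : IsProb Q) {g : β → ℝ}
    (hg : ∀ y, 0 ≤ g y) {e : ℝ} (he : 0 ≤ e)
    (h : ∀ y, 0 < Q y → 0 < g y →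
      ∑ z with Q z ≤ Q y, Q z * g z ≤ ∑ x with P x ≤ e * Q y, P x) :
    ∑ y, Q y * √(g y) - √e ≤ FD P Q := by
  classical
  obtain ⟨S, hd, hS⟩ := exists_disjoint_fill hP (Q := Q) (T := fun y => Q y * g y)
    (fun y => mul_nonneg (hQ.1 y) (hg y)) he hQ.1 (fun y hy => h y
      (pos_of_mul_pos_left hy (hg y)) (pos_of_mul_pos_right hy (hQ.1 y)))
  let W : α → β := fun x => if hx : ∃ y, x ∈ S y then hx.choose else Classical.arbitrary β
  have hW : ∀ y, ∀ x ∈ S y, W x = y := by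
    intro y x hx
    have hex : ∃ y, x ∈ S y := ⟨y, hx⟩
    have h1 : W x = hex.choose := by simp only [W, dif_pos hex]
    rw [h1]
    by_contra hne
    exact Finset.disjoint_left.1 (hd _ _ hne) hex.choose_spec hx
  have hpush : ∀ y, Q y * (g y - e) ≤ push W P y := fun y => by
    have h1 : ∑ x ∈ S y, P x ≤ push W P y := by
      rw [push, ← Finset.sum_filter]
      refine Finset.sum_le_sum_of_subset_of_nonneg (fun x hx => ?_) fun x _ _ => hP x
      simpa using hW y x hx
    have := hS y
    linarith
  refine le_trans ?_ (fid_push_le_FD P Q W)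
  have h2 : ∑ y, Q y * √(g y) - √e = ∑ y, Q y * (√(g y) - √e) := by
    simp only [mul_sub, Finset.sum_sub_distrib, ← Finset.sum_mul, hQ.2, one_mul]
  rw [h2]
  refine Finset.sum_le_sum fun y _ => ?_
  have h3 : √(g y) ≤ √(g y - e) + √e := by
    rcases le_total e (g y) with h | h
    · simpa using sqrt_add_le_add_sqrt' (sub_nonneg.2 h) he
    · exact (Real.sqrt_le_sqrt h).trans (by simp)
  calc Q y * (√(g y) - √e) ≤ Q y * √(g y - e) :=
        mul_le_mul_of_nonneg_left (by linarith) (hQ.1 y)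
    _ = √(Q y * (g y - e) * Q y) := by
        rw [show Q y * (g y - e) * Q y = (Q y * Q y) * (g y - e) by ring,
          Real.sqrt_mul (mul_self_nonneg _), Real.sqrt_mul_self (hQ.1 y)]
    _ ≤ _ := Real.sqrt_le_sqrt (mul_le_mul_of_nonneg_right (hpush y) (hQ.1 y))

end OneShot

section Iid
variable [Fintype α] [Fintype β]

lemma iid_nonneg {P : α → ℝ} (hP : IsProb P) (n : ℕ) (f : Fin n → α) : 0 ≤ iid P n f :=
  Finset.prod_nonneg fun i _ => hP.1 (f i)

lemma isProb_iid {P : α → ℝ} (hP : IsProb P) (n : ℕ) : IsProb (iid P n) := by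
  classical
  refine ⟨iid_nonneg hP n, ?_⟩
  have := Finset.prod_univ_sum (fun _ : Fin n => (Finset.univ : Finset α)) (fun _ x => P x)
  simp only [hP.2, Finset.prod_const_one, Fintype.piFinset_univ] at this
  exact this.symm

lemma nonempty_of_isProb {P : α → ℝ} (hP : IsProb P) : Nonempty α := by
  by_contra h
  rw [not_nonempty_iff] at h
  simpa using hP.2

lemma push_tail_iid {Q : β → ℝ} (hQ : IsProb Q) (n : ℕ) :
    push (Fin.tail : (Fin (n + 1) → β) → (Fin n → β)) (iid Q (n + 1)) = iid Q n := by
  classical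
  funext z
  rw [push, ← (Fin.consEquiv fun _ : Fin (n + 1) => β).sum_comp, Fintype.sum_prod_type]
  simp [iid, Fin.prod_univ_succ, ← Finset.sum_mul, hQ.2, Fin.consEquiv]

lemma FD_iid_antitone {P : α → ℝ} (hP : IsProb P) {Q : β → ℝ} (hQ : IsProb Q) :
    Antitone fun L => FD P (iid Q L) := by
  have := nonempty_of_isProb hQ
  refine antitone_nat_of_succ_le fun n => FD_le fun W => ?_
  refine (fid_push_le_fid Fin.tail (push_nonneg W hP.1) (isProb_iid hQ (n + 1)).1).trans ?_
  rw [push_comp, push_tail_iid hQ]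
  exact fid_push_le_FD _ _ _

end Iid

section WeakConvergence
open ProbabilityTheory Topology BoundedContinuousFunction

lemma normalPDF_eq {m v : ℝ} (hv : 0 ≤ v) (x : ℝ) :
    normalPDF m v x = gaussianPDFReal m v.toNNReal x := by
  simp [normalPDF, gaussianPDFReal, Real.coe_toNNReal v hv]

variable [Fintype β]

/-- The measure on a finite (discrete) space with point masses `R`. -/
noncomputable def pointMeasure [MeasurableSpace β] (R : β → ℝ) : Measure β :=
  ∑ y, ENNReal.ofReal (R y) • Measure.dirac y

lemma pointMeasure_singleton [MeasurableSpace β] [MeasurableSingletonClass β] (R : β → ℝ) (y : β) :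
    pointMeasure R {y} = ENNReal.ofReal (R y) := by
  classical
  rw [pointMeasure, Measure.finsetSum_apply, Finset.sum_eq_single y] <;>
    simp +contextual [Set.indicator]

lemma isProbabilityMeasure_pointMeasure [MeasurableSpace β] {R : β → ℝ} (hR : IsProb R) :
    IsProbabilityMeasure (pointMeasure R) := by
  constructor
  simp only [pointMeasure, Measure.finsetSum_apply, Measure.smul_apply, measure_univ, smul_eq_mul,
    mul_one]
  rw [← ENNReal.ofReal_sum_of_nonneg fun y _ => hR.1 y, hR.2, ENNReal.ofReal_one]

lemma integral_pointMeasure [MeasurableSpace β] [MeasurableSingletonClass β] {R : β → ℝ}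
    (hR : IsProb R) (f : β → ℝ) : ∫ y, f y ∂pointMeasure R = ∑ y, R y * f y := by
  have := isProbabilityMeasure_pointMeasure hR
  rw [integral_fintype .of_finite]
  simp [Measure.real, pointMeasure_singleton, ENNReal.toReal_ofReal (hR.1 _)]

lemma integral_infinitePi_pointMeasure [MeasurableSpace β] [MeasurableSingletonClass β]
    {R : β → ℝ} (hR : IsProb R) (k : ℕ) (F : (Fin k → β) → ℝ) :
    ∫ ω, F (fun i => ω i) ∂Measure.infinitePi (fun _ : ℕ => pointMeasure R) =
      ∑ f, iid R k f * F f := by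
  have := isProbabilityMeasure_pointMeasure hR
  have hmap := Measure.map_infinitePi_infinitePi_of_inj (P := fun _ : ℕ => pointMeasure R)
    (Fin.val_injective (n := k))
  have hF : Measurable F := measurable_of_finite F
  rw [← integral_map (φ := fun (ω : ℕ → β) (i : Fin k) => ω i)
    (measurable_pi_lambda _ fun i => measurable_pi_apply _).aemeasurable
    hF.aestronglyMeasurable, hmap, Measure.infinitePi_eq_pi, integral_fintype .of_finite]
  refine Finset.sum_congr rfl fun f _ => ?_
  simp only [Measure.real, Measure.pi_singleton, pointMeasure_singleton, smul_eq_mul, iid]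
  rw [ENNReal.toReal_prod]
  simp [ENNReal.toReal_ofReal (hR.1 _)]

lemma iid_mul_congr_log {R : β → ℝ} (k : ℕ) (f : Fin k → β) (F : ℝ → ℝ) :
    iid R k f * F (-Real.log (iid R k f)) = iid R k f * F (∑ i, -Real.log (R (f i))) := by
  by_cases h : iid R k f = 0
  · simp [h]
  · have h' : ∀ i ∈ Finset.univ, R (f i) ≠ 0 := Finset.prod_ne_zero_iff.1 h
    rw [Finset.sum_neg_distrib, iid, Real.log_prod h']

/-- Central limit theorem for the self-information of an i.i.d. source. -/
lemma tendsto_sum_iid_log {R : β → ℝ} (hR : IsProb R) (hV : 0 < V R) {k : ℕ → ℕ} {a : ℝ}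
    (ha : 0 < a) (hk : Tendsto (fun n : ℕ => (k n : ℝ) / n) atTop (𝓝 a)) {c : ℕ → ℝ} {c₀ : ℝ}
    (hc : Tendsto c atTop (𝓝 c₀)) {h : ℝ → ℝ} (hh : Continuous h) {C : ℝ} (hC : ∀ x, |h x| ≤ C) :
    Tendsto (fun n : ℕ => ∑ f, iid R (k n) f *
      h ((-Real.log (iid R (k n) f) - k n * H R) / √n + c n)) atTop
      (𝓝 (∫ x, normalPDF c₀ (a * V R) x * h x)) := by
  let _ : MeasurableSpace β := ⊤
  have : DiscreteMeasurableSpace β := ⟨fun _ => trivial⟩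
  have := isProbabilityMeasure_pointMeasure hR
  set μ := Measure.infinitePi (fun _ : ℕ => pointMeasure R) with hμ
  set L : β → ℝ := fun y => -Real.log (R y) with hL
  set X : ℕ → (ℕ → β) → ℝ := fun i ω => L (ω i) with hX
  have hLm : Measurable L := measurable_of_finite L
  have hmap : ∀ i, μ.map (fun ω => ω i) = pointMeasure R := fun i =>
    Measure.infinitePi_map_eval _ i
  have hcoord : ∀ F : β → ℝ, ∫ ω, F (ω 0) ∂μ = ∑ y, R y * F y := fun F => by
    rw [← integral_pointMeasure hR, ← hmap 0, integral_map (measurable_pi_apply 0).aemeasurable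
      (measurable_of_finite F).aestronglyMeasurable]
  have hmean : ∫ ω, X 0 ω ∂μ = H R := by
    rw [hX, hcoord L, H]; simp [hL]
  have hvar : Var[X 0; μ] = V R := by
    rw [variance_eq_integral (by fun_prop), hmean]
    exact hcoord fun y => (L y - H R) ^ 2
  have hmem : MemLp (X 0) 2 μ := by
    obtain ⟨K, hK⟩ := (Set.finite_range fun y => ‖L y‖).bddAbove
    exact MemLp.of_bound (by fun_prop) K (.of_forall fun ω => hK ⟨ω 0, rfl⟩)
  have hindep : iIndepFun X μ := iIndepFun_infinitePi (X := fun _ => L) fun _ => hLm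
  have hident : ∀ i, IdentDistrib (X i) (X 0) μ μ := fun i => by
    have : IdentDistrib (fun ω : ℕ → β => ω i) (fun ω => ω 0) μ μ :=
      ⟨(measurable_pi_apply i).aemeasurable, (measurable_pi_apply 0).aemeasurable,
        by rw [hmap, hmap]⟩
    exact this.comp hLm
  have hlaw : HasLaw id (gaussianReal 0 Var[X 0; μ].toNNReal)
    (gaussianReal 0 Var[X 0; μ].toNNReal) := HasLaw.id
  have clt := tendstoInDistribution_inv_sqrt_mul_sum_sub hlaw hmem hindep hident
  rw [hmean, hvar] at clt
  have hk' : Tendsto k atTop atTop := by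
    have h1 : Tendsto (fun n : ℕ => (k n : ℝ) / n * n) atTop atTop :=
      hk.pos_mul_atTop ha tendsto_natCast_atTop_atTop
    refine tendsto_natCast_atTop_iff.1 (h1.congr' ?_)
    filter_upwards [eventually_gt_atTop 0] with n hn
    field_simp
  have cltk : TendstoInDistribution
      (fun (n : ℕ) ω => (√(k n))⁻¹ * (∑ i ∈ Finset.range (k n), X i ω - k n * H R)) atTop id
      (fun _ => μ) (gaussianReal 0 (V R).toNNReal) :=
    ⟨fun n => clt.forall_aemeasurable (k n), clt.aemeasurable_limit, clt.tendsto.comp hk'⟩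
  have hYt : Tendsto (fun n => (√(k n) / √n, c n)) atTop (𝓝 (√a, c₀)) := by
    refine Tendsto.prodMk_nhds ?_ hc
    simp_rw [← Real.sqrt_div (Nat.cast_nonneg _)]
    exact hk.sqrt
  have hY : TendstoInMeasure μ (fun n (_ : ℕ → β) => (√(k n) / √n, c n)) atTop
      (fun _ => (√a, c₀)) :=
    tendstoInMeasure_of_tendsto_ae (fun n => aestronglyMeasurable_const)
      (.of_forall fun _ => hYt)
  have slut := cltk.continuous_comp_prodMk_of_tendstoInMeasure_const
    (g := fun z : ℝ × (ℝ × ℝ) => z.2.1 * z.1 + z.2.2) (by fun_prop) hY (fun _ => aemeasurable_const)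
  let hb : ℝ →ᵇ ℝ := BoundedContinuousFunction.ofNormedAddCommGroup h hh C hC
  have lim := (ProbabilityMeasure.tendsto_iff_forall_integral_tendsto.1 slut.tendsto) hb
  simp only [ProbabilityMeasure.coe_mk] at lim
  have hlim : ∫ x, hb x ∂((gaussianReal 0 (V R).toNNReal).map fun ω => √a * id ω + c₀) =
      ∫ x, normalPDF c₀ (a * V R) x * h x := by
    have e1 : (gaussianReal 0 (V R).toNNReal).map (fun ω => √a * id ω + c₀) =
        gaussianReal c₀ (a * V R).toNNReal := by
      have := Measure.map_map (μ := gaussianReal 0 (V R).toNNReal) (g := fun x => x + c₀)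
        (f := fun x => √a * x) (by fun_prop) (by fun_prop)
      rw [gaussianReal_map_const_mul, gaussianReal_map_add_const] at this
      rw [show (fun ω => √a * id ω + c₀) = (fun x => x + c₀) ∘ (fun x => √a * x) from rfl, ← this]
      congr 1
      · simp
      · ext
        simp [Real.sq_sqrt ha.le, hV.le, mul_nonneg ha.le hV.le]
    have hne : (a * V R).toNNReal ≠ 0 := by simpa using mul_pos ha hV
    rw [e1, integral_gaussianReal_eq_integral_smul hne]
    refine integral_congr_ae (.of_forall fun x => ?_)
    simp [normalPDF_eq (mul_pos ha hV).le, hb]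
  rw [hlim] at lim
  refine lim.congr fun n => ?_
  rw [integral_map (slut.forall_aemeasurable n) hb.continuous.aestronglyMeasurable]
  have e2 := integral_infinitePi_pointMeasure hR (k n)
    (fun f => h ((∑ i, -Real.log (R (f i)) - k n * H R) / √n + c n))
  rw [show (∑ f, iid R (k n) f * h ((-Real.log (iid R (k n) f) - k n * H R) / √n + c n)) =
      ∑ f, iid R (k n) f * h ((∑ i, -Real.log (R (f i)) - k n * H R) / √n + c n) from
    Finset.sum_congr rfl fun f _ =>
      iid_mul_congr_log (k n) f fun x => h ((x - k n * H R) / √n + c n), ← e2]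
  refine integral_congr_ae (.of_forall fun ω => ?_)
  simp only [hb, BoundedContinuousFunction.coe_ofNormedAddCommGroup, hX, hL]
  congr 2
  rw [Finset.sum_range]
  rcases Nat.eq_zero_or_pos (k n) with h0 | h0
  · have : IsEmpty (Fin (k n)) := by rw [h0]; infer_instance
    simp [h0]
  · have : √(k n : ℝ) ≠ 0 := by positivity
    field_simp

end WeakConvergence

section Asymptotics
open Topology Set

/-- The number of target copies with first order rate `H(P)/H(Q)` and second order rate `b`. -/
noncomputable def blockLength [Fintype α] [Fintype β] (P : α → ℝ) (Q : β → ℝ) (b : ℝ) (n : ℕ) : ℕ :=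
  ⌊H P / H Q * n + b * √n⌋₊

variable [Fintype α] [Fintype β] {P : α → ℝ} {Q : β → ℝ}

lemma IsProb.le_one (hP : IsProb P) (x : α) : P x ≤ 1 :=
  hP.2 ▸ Finset.single_le_sum (fun y _ => hP.1 y) (Finset.mem_univ x)

lemma H_pos (hP : IsProb P) (hV : 0 < V P) : 0 < H P := by
  have h0 : ∀ x ∈ Finset.univ, 0 ≤ -(P x * Real.log (P x)) := fun x _ => by
    have := mul_nonneg (hP.1 x) (neg_nonneg.2 (Real.log_nonpos (hP.1 x) (hP.le_one x)))
    linarith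
  refine lt_of_le_of_ne (Finset.sum_nonneg h0) fun hH => hV.ne' ?_
  have h1 := (Finset.sum_eq_zero_iff_of_nonneg h0).1 hH.symm
  refine Finset.sum_eq_zero fun x hx => ?_
  rw [← hH]
  have := h1 x hx
  rcases mul_eq_zero.1 (neg_eq_zero.1 this) with h | h <;> simp [h]

lemma tendsto_inv_sqrt_natCast : Tendsto (fun n : ℕ => (√(n : ℝ))⁻¹) atTop (𝓝 0) :=
  (Real.tendsto_sqrt_atTop.comp tendsto_natCast_atTop_atTop).inv_tendsto_atTop

lemma tendsto_sqrt_sqrt_div_sqrt : Tendsto (fun n : ℕ => √√(n : ℝ) / √n) atTop (𝓝 0) := by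
  have := (Real.tendsto_sqrt_atTop.comp
    (Real.tendsto_sqrt_atTop.comp tendsto_natCast_atTop_atTop)).inv_tendsto_atTop
  refine (this : Tendsto _ (atTop : Filter ℕ) _).congr fun n => ?_
  rw [Real.sqrt_div_self']
  simp

lemma tendsto_sqrt_exp_neg_sqrt_sqrt :
    Tendsto (fun n : ℕ => √(Real.exp (-√√(n : ℝ)))) atTop (𝓝 0) := by
  have := Real.tendsto_exp_neg_atTop_nhds_zero.comp (Real.tendsto_sqrt_atTop.comp
    (Real.tendsto_sqrt_atTop.comp (tendsto_natCast_atTop_atTop (R := ℝ))))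
  simpa using this.sqrt

lemma tendsto_sub_div_sqrt_blockLength (hP : 0 < H P) (hQ : 0 < H Q) (b : ℝ) :
    Tendsto (fun n : ℕ => ((blockLength P Q b n : ℝ) - H P / H Q * n) / √n) atTop (𝓝 b) := by
  have hr : 0 < H P / H Q := div_pos hP hQ
  have hlim : Tendsto (fun n : ℕ => √(n : ℝ) * (H P / H Q * √n + b)) atTop atTop := by
    have hs : Tendsto (fun n : ℕ => √(n : ℝ)) atTop atTop :=
      Real.tendsto_sqrt_atTop.comp tendsto_natCast_atTop_atTop
    exact hs.atTop_mul_atTop₀ (tendsto_atTop_add_const_right _ _ (hs.const_mul_atTop hr))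
  have hlow : Tendsto (fun n : ℕ => b - (√(n : ℝ))⁻¹) atTop (𝓝 b) := by
    simpa using tendsto_const_nhds.sub tendsto_inv_sqrt_natCast
  refine tendsto_of_tendsto_of_tendsto_of_le_of_le' hlow tendsto_const_nhds ?_ ?_
  · filter_upwards [eventually_gt_atTop 0] with n hn
    have hn' : 0 < √(n : ℝ) := by positivity
    have := Nat.lt_floor_add_one (H P / H Q * n + b * √n)
    rw [le_div_iff₀ hn', blockLength, sub_mul, inv_mul_cancel₀ hn'.ne']
    linarith
  · filter_upwards [eventually_gt_atTop 0, hlim.eventually_ge_atTop 0] with n hn h0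
    have hn' : 0 < √(n : ℝ) := by positivity
    have h1 : √(n : ℝ) * (H P / H Q * √n + b) = H P / H Q * n + b * √n := by
      have := Real.mul_self_sqrt (Nat.cast_nonneg (α := ℝ) n)
      linear_combination H P / H Q * this
    have := Nat.floor_le (h1 ▸ h0)
    rw [div_le_iff₀ hn', blockLength]
    linarith

lemma tendsto_blockLength_div (hP : 0 < H P) (hQ : 0 < H Q) (b : ℝ) :
    Tendsto (fun n : ℕ => (blockLength P Q b n : ℝ) / n) atTop (𝓝 (H P / H Q)) := by
  have := ((tendsto_sub_div_sqrt_blockLength hP hQ b).mul tendsto_inv_sqrt_natCast).add_const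
    (H P / H Q)
  rw [mul_zero, zero_add] at this
  refine this.congr' ?_
  filter_upwards [eventually_gt_atTop 0] with n hn
  have hn' : 0 < (n : ℝ) := by positivity
  have := Real.sq_sqrt hn'.le
  have : √(n : ℝ) ≠ 0 := by positivity
  rw [div_mul_eq_mul_div, ← div_eq_mul_inv, div_div, ← sq, Real.sq_sqrt hn'.le]
  field_simp
  ring

lemma tendsto_sum_iid_source (hP : IsProb P) (hV : 0 < V P) {d : ℕ → ℝ}
    (hd : Tendsto d atTop (𝓝 0)) {h : ℝ → ℝ} (hh : Continuous h) {C : ℝ} (hC : ∀ x, |h x| ≤ C) :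
    Tendsto (fun n : ℕ => ∑ f, iid P n f * h ((-Real.log (iid P n f) - n * H P) / √n + d n)) atTop
      (𝓝 (∫ x, NP P x * h x)) := by
  have := tendsto_sum_iid_log hP hV (k := id) zero_lt_one (tendsto_const_nhds.congr' ?_) hd hh hC
  · simpa [NP] using this
  · filter_upwards [eventually_gt_atTop 0] with n hn
    have : (n : ℝ) ≠ 0 := by positivity
    simp [this]

lemma tendsto_sum_iid_target (hP : 0 < H P) (hQ : IsProb Q) (hV : 0 < V Q) (b : ℝ)
    {h : ℝ → ℝ} (hh : Continuous h) {C : ℝ} (hC : ∀ x, |h x| ≤ C) :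
    Tendsto (fun n : ℕ => ∑ f, iid Q (blockLength P Q b n) f *
      h ((-Real.log (iid Q (blockLength P Q b n) f) - n * H P) / √n)) atTop
      (𝓝 (∫ x, NPQ P Q b x * h x)) := by
  have hHQ := H_pos hQ hV
  have hc : Tendsto (fun n : ℕ => (blockLength P Q b n * H Q - n * H P) / √n) atTop
      (𝓝 (H Q * b)) := by
    refine ((tendsto_sub_div_sqrt_blockLength hP hHQ b).const_mul (H Q)).congr fun n => ?_
    field_simp
  have := tendsto_sum_iid_log hQ hV (div_pos hP hHQ) (tendsto_blockLength_div hP hHQ b) hc hh hC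
  refine this.congr fun n => Finset.sum_congr rfl fun f _ => ?_
  congr 2
  ring

/-- Converse bound: a monotone test function yields an asymptotic upper bound on the fidelity. -/
lemma eventually_FD_lt (hP : IsProb P) (hVP : 0 < V P) (hQ : IsProb Q) (hVQ : 0 < V Q) (b : ℝ)
    {s : ℝ → ℝ} (hs : Continuous s) (hmono : Monotone s) {κ C : ℝ} (hκ : 0 < κ)
    (hκs : ∀ x, κ ≤ s x) (hC : ∀ x, s x ≤ C) {θ : ℝ}
    (hθ : (∫ x, NP P x * s x) / 2 + (∫ x, NPQ P Q b x * (s x)⁻¹) / 2 < θ) :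
    ∀ᶠ n : ℕ in atTop, FD (iid P n) (iid Q (blockLength P Q b n)) < θ := by
  have hs0 : ∀ x, 0 < s x := fun x => hκ.trans_le (hκs x)
  have hA := tendsto_sum_iid_source hP hVP tendsto_sqrt_sqrt_div_sqrt hs (C := C)
    fun x => by rw [abs_of_pos (hs0 x)]; exact hC x
  have hB := tendsto_sum_iid_target (H_pos hP hVP) hQ hVQ b (hs.inv₀ fun x => (hs0 x).ne')
    (C := κ⁻¹) fun x => by
      rw [Pi.inv_apply, abs_of_pos (inv_pos.2 (hs0 x))]
      exact inv_anti₀ hκ (hκs x)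
  have hlim := (tendsto_sqrt_exp_neg_sqrt_sqrt.add (hA.div_const 2)).add (hB.div_const 2)
  rw [zero_add] at hlim
  have := nonempty_of_isProb hQ
  filter_upwards [hlim.eventually_lt_const hθ, eventually_gt_atTop 0] with n hn hn0
  refine (FD_le fun W => ?_).trans_lt hn
  have hn' : 0 < √(n : ℝ) := by positivity
  refine fid_push_le (isProb_iid hP n) (iid_nonneg hQ _) W (Real.exp_pos _).le
    (s := fun y => s ((-Real.log (iid Q (blockLength P Q b n) y) - n * H P) / √n))
    (fun y => hs0 _) (fun y => mul_inv_cancel₀ (hs0 _).ne') (fun x => (hs0 _).le) fun x hx hlt => ?_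
  refine hmono ?_
  have := Real.log_lt_log (mul_pos (Real.exp_pos _) hx) hlt
  rw [Real.log_mul (Real.exp_pos _).ne' hx.ne', Real.log_exp] at this
  rw [← add_div]
  gcongr
  linarith

end Asymptotics

section Tails
open Topology Set

lemma normalPDF_pos {m v : ℝ} (hv : 0 < v) (x : ℝ) : 0 < normalPDF m v x := by
  rw [normalPDF]
  positivity

@[fun_prop]
lemma continuous_normalPDF (m v : ℝ) : Continuous (normalPDF m v) := by
  unfold normalPDF
  fun_prop

lemma integrable_normalPDF (m : ℝ) {v : ℝ} (hv : 0 < v) : Integrable (normalPDF m v) := by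
  rw [funext (normalPDF_eq hv.le)]
  exact ProbabilityTheory.integrable_gaussianPDFReal m _

lemma integral_normalPDF (m : ℝ) {v : ℝ} (hv : 0 < v) : ∫ x, normalPDF m v x = 1 := by
  rw [funext (normalPDF_eq hv.le)]
  exact ProbabilityTheory.integral_gaussianPDFReal_eq_one m (by simpa using hv)

lemma continuous_integral_Ioi {F : ℝ → ℝ} (hF : Integrable F) :
    Continuous fun z => ∫ x in Ioi z, F x := by
  have h : ∀ z, ∫ x in Ioi z, F x = (∫ x in Ioi 0, F x) - ∫ x in (0 : ℝ)..z, F x := fun z => by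
    rw [← intervalIntegral.integral_Ioi_sub_Ioi' hF.integrableOn hF.integrableOn]
    ring
  rw [funext h]
  exact continuous_const.sub
    (intervalIntegral.continuous_primitive (fun a b => hF.intervalIntegrable) 0)

lemma setIntegral_Ioi_eq (F : ℝ → ℝ) (z : ℝ) :
    ∫ x in Ioi z, F x = ∫ x, F x * if z < x then 1 else 0 := by
  rw [← integral_indicator measurableSet_Ioi]
  refine integral_congr_ae (.of_forall fun x => ?_)
  by_cases h : z < x <;> simp [h]

/-- The piecewise linear function equal to `0` left of `a` and to `1` right of `a + η`. -/
noncomputable def ramp (a η x : ℝ) : ℝ := max 0 (min 1 ((x - a) / η))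

@[fun_prop]
lemma continuous_ramp (a η : ℝ) : Continuous (ramp a η) := by
  unfold ramp
  fun_prop

lemma ramp_nonneg (a η x : ℝ) : 0 ≤ ramp a η x := le_max_left _ _

lemma ramp_le_one (a η x : ℝ) : ramp a η x ≤ 1 := max_le zero_le_one (min_le_left _ _)

lemma abs_ramp_le_one (a η x : ℝ) : |ramp a η x| ≤ 1 := by
  rw [abs_of_nonneg (ramp_nonneg a η x)]
  exact ramp_le_one a η x

lemma ramp_le_ite {a η : ℝ} (hη : 0 < η) (x : ℝ) : ramp a η x ≤ if a < x then 1 else 0 := by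
  split_ifs with h
  · exact ramp_le_one a η x
  · refine max_le le_rfl ((min_le_right _ _).trans ?_)
    exact div_nonpos_of_nonpos_of_nonneg (by linarith) hη.le

lemma ite_le_ramp {a η : ℝ} (hη : 0 < η) (x : ℝ) :
    (if a + η ≤ x then 1 else 0) ≤ ramp a η x := by
  split_ifs with h
  · refine le_max_of_le_right (le_min le_rfl ?_)
    rw [one_le_div hη]
    linarith
  · exact ramp_nonneg a η x

end Tails

section Achievability
open Topology Set

lemma eventually_forall_of_isCompact {ι γ : Type*} [TopologicalSpace γ] {l : Filter ι} {s : Set γ}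
    (hs : IsCompact s) {p : ι → γ → Prop}
    (h : ∀ z ∈ s, ∃ t ∈ 𝓝 z, ∀ᶠ n in l, ∀ ζ ∈ t, p n ζ) : ∀ᶠ n in l, ∀ ζ ∈ s, p n ζ := by
  refine hs.induction_on (p := fun s => ∀ᶠ n in l, ∀ ζ ∈ s, p n ζ) (by simp) ?_ ?_ ?_
  · exact fun s t hst h => h.mono fun n hn ζ hζ => hn ζ (hst hζ)
  · exact fun s t hs ht => (hs.and ht).mono fun n hn ζ hζ => hζ.elim (hn.1 ζ) (hn.2 ζ)
  · intro z hz
    obtain ⟨t, ht, h⟩ := h z hz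
    exact ⟨t, mem_nhdsWithin_of_mem_nhds ht, h⟩

variable [Fintype α] [Fintype β] {P : α → ℝ} {Q : β → ℝ}

/-- Locally uniform comparison of tail masses of the information spectra. -/
lemma exists_nhds_eventually_tail_le (hP : IsProb P) (hVP : 0 < V P) (hQ : IsProb Q)
    (hVQ : 0 < V Q) (b : ℝ) {g : ℝ → ℝ} (hg : Continuous g) (hg0 : ∀ x, 0 ≤ g x) {C : ℝ}
    (hC : ∀ x, g x ≤ C) {z₀ : ℝ}
    (ht : ∫ x in Ioi z₀, NPQ P Q b x * g x < ∫ x in Ioi z₀, NP P x) :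
    ∃ t ∈ 𝓝 z₀, ∀ᶠ n : ℕ in atTop, ∀ ζ ∈ t,
      ∑ f, iid Q (blockLength P Q b n) f *
        (if ζ ≤ (-Real.log (iid Q (blockLength P Q b n) f) - n * H P) / √n then
          g ((-Real.log (iid Q (blockLength P Q b n) f) - n * H P) / √n) else 0) ≤
      ∑ f, iid P n f *
        (if ζ ≤ (-Real.log (iid P n f) - n * H P) / √n - √√n / √n then 1 else 0) := by
  have hHP := H_pos hP hVP
  have hHQ := H_pos hQ hVQ
  have hv : 0 < H P / H Q * V Q := by positivity
  have hqi : Integrable (NPQ P Q b) := integrable_normalPDF _ hv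
  have hqg : Integrable fun x => NPQ P Q b x * g x :=
    hqi.mul_bdd (c := C) hg.aestronglyMeasurable
      (.of_forall fun x => by rw [Real.norm_of_nonneg (hg0 x)]; exact hC x)
  have hpi : Integrable (NP P) := integrable_normalPDF _ hVP
  have hc : Continuous fun z => (∫ x in Ioi (z₀ + 2 * z), NP P x) -
      ∫ x in Ioi (z₀ - 2 * z), NPQ P Q b x * g x :=
    ((continuous_integral_Ioi hpi).comp (by fun_prop)).sub
      ((continuous_integral_Ioi hqg).comp (by fun_prop))
  have hev := hc.continuousAt (x := 0) |>.eventually_const_lt (u := 0) (by simpa using ht)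
  obtain ⟨η, hη, hη'⟩ := ((hev.filter_mono nhdsWithin_le_nhds).and
    (self_mem_nhdsWithin (s := Ioi (0 : ℝ)))).exists
  replace hη' : 0 < η := hη'
  refine ⟨Ioo (z₀ - η) (z₀ + η), Ioo_mem_nhds (by linarith) (by linarith), ?_⟩
  have hA := tendsto_sum_iid_target hHP hQ hVQ b (h := fun x => ramp (z₀ - 2 * η) η x * g x)
    (by fun_prop) (C := C) fun x => by
      rw [abs_mul, abs_of_nonneg (hg0 x), abs_of_nonneg (ramp_nonneg _ _ _)]
      exact (mul_le_of_le_one_left (hg0 x) (ramp_le_one _ _ _)).trans (hC x)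
  have hd := tendsto_sqrt_sqrt_div_sqrt.neg
  rw [neg_zero] at hd
  have hB := tendsto_sum_iid_source hP hVP hd (continuous_ramp (z₀ + η) η)
    (abs_ramp_le_one (z₀ + η) η)
  have hlt : ∫ x, NPQ P Q b x * (ramp (z₀ - 2 * η) η x * g x) <
      ∫ x, NP P x * ramp (z₀ + η) η x := by
    calc ∫ x, NPQ P Q b x * (ramp (z₀ - 2 * η) η x * g x)
        ≤ ∫ x in Ioi (z₀ - 2 * η), NPQ P Q b x * g x := by
          rw [setIntegral_Ioi_eq]
          refine integral_mono_of_nonneg (.of_forall fun x => ?_) ?_ (.of_forall fun x => ?_)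
          · exact mul_nonneg (normalPDF_pos hv x).le (mul_nonneg (ramp_nonneg _ _ _) (hg0 x))
          · refine hqg.mul_bdd (c := 1) (Measurable.ite measurableSet_Ioi measurable_const
              measurable_const).aestronglyMeasurable (.of_forall fun x => ?_)
            split_ifs <;> simp
          · dsimp only
            rw [mul_assoc, mul_comm (g x)]
            exact mul_le_mul_of_nonneg_left
              (mul_le_mul_of_nonneg_right (ramp_le_ite hη' x) (hg0 x)) (normalPDF_pos hv x).le
      _ < ∫ x in Ioi (z₀ + 2 * η), NP P x := by linarith
      _ ≤ ∫ x, NP P x * ramp (z₀ + η) η x := by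
          rw [setIntegral_Ioi_eq]
          refine integral_mono_of_nonneg (.of_forall fun x => ?_) ?_ (.of_forall fun x => ?_)
          · exact mul_nonneg (normalPDF_pos hVP x).le (by split_ifs <;> simp)
          · exact hpi.mul_bdd (c := 1) (continuous_ramp _ _).aestronglyMeasurable
              (.of_forall (abs_ramp_le_one _ _))
          · refine mul_le_mul_of_nonneg_left (le_trans ?_ (ite_le_ramp hη' x))
              (normalPDF_pos hVP x).le
            split_ifs <;> first | exact le_rfl | exact zero_le_one | linarith
  filter_upwards [hA.eventually_lt hB hlt] with n hn ζ hζ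
  refine le_trans ?_ (hn.le.trans ?_)
  · refine Finset.sum_le_sum fun f _ => mul_le_mul_of_nonneg_left ?_ (iid_nonneg hQ _ f)
    set Z := (-Real.log (iid Q (blockLength P Q b n) f) - n * H P) / √n
    split_ifs with h
    · refine le_mul_of_one_le_left (hg0 _) (le_trans ?_ (ite_le_ramp hη' Z))
      rw [if_pos (by linarith [hζ.1])]
    · exact mul_nonneg (ramp_nonneg _ _ _) (hg0 _)
  · refine Finset.sum_le_sum fun f _ => mul_le_mul_of_nonneg_left ?_ (iid_nonneg hP _ f)
    rw [← sub_eq_add_neg]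
    refine (ramp_le_ite hη' _).trans ?_
    split_ifs <;> first | exact le_rfl | exact zero_le_one | linarith [hζ.2]

/-- Achievability bound: a compactly supported density ratio whose tails are strictly dominated
by those of the source yields an asymptotic lower bound on the fidelity. -/
lemma eventually_lt_FD (hP : IsProb P) (hVP : 0 < V P) (hQ : IsProb Q) (hVQ : 0 < V Q) (b : ℝ)
    {g : ℝ → ℝ} (hg : Continuous g) (hg0 : ∀ x, 0 ≤ g x) {M : ℝ} (hM : ∀ x, M < |x| → g x = 0)
    (ht : ∀ z, ∫ x in Ioi z, NPQ P Q b x * g x < ∫ x in Ioi z, NP P x) {θ : ℝ}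
    (hθ : θ < ∫ x, NPQ P Q b x * √(g x)) :
    ∀ᶠ n : ℕ in atTop, θ < FD (iid P n) (iid Q (blockLength P Q b n)) := by
  have := nonempty_of_isProb hQ
  obtain ⟨C, hC⟩ := hg.bounded_above_of_compact_support
    (HasCompactSupport.intro (isCompact_Icc (a := -M) (b := M)) fun x hx => hM x (by
      by_contra! h
      exact hx (abs_le.1 h)))
  have hC' : ∀ x, g x ≤ C := fun x => (le_abs_self _).trans (hC x)
  have hunif : ∀ᶠ n : ℕ in atTop, ∀ ζ ∈ Icc (-M) M,
      ∑ f, iid Q (blockLength P Q b n) f *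
        (if ζ ≤ (-Real.log (iid Q (blockLength P Q b n) f) - n * H P) / √n then
          g ((-Real.log (iid Q (blockLength P Q b n) f) - n * H P) / √n) else 0) ≤
      ∑ f, iid P n f *
        (if ζ ≤ (-Real.log (iid P n f) - n * H P) / √n - √√n / √n then 1 else 0) := by
    exact eventually_forall_of_isCompact isCompact_Icc fun z _ =>
      exists_nhds_eventually_tail_le hP hVP hQ hVQ b hg hg0 hC' (ht z)
  have hlim := (tendsto_sum_iid_target (H_pos hP hVP) hQ hVQ b hg.sqrt (C := √C)
    fun x => by
      rw [abs_of_nonneg (Real.sqrt_nonneg _)]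
      exact Real.sqrt_le_sqrt (hC' x)).sub tendsto_sqrt_exp_neg_sqrt_sqrt
  rw [sub_zero] at hlim
  filter_upwards [hlim.eventually_const_lt hθ, eventually_gt_atTop 0, hunif] with n hn hn0 hu
  refine hn.trans_le ?_
  have hn' : 0 < √(n : ℝ) := by positivity
  refine le_FD (iid_nonneg hP _) (isProb_iid hQ _) (fun y => hg0 _) (Real.exp_pos _).le
    fun y hy hgy => ?_
  have hyM : (-Real.log (iid Q (blockLength P Q b n) y) - n * H P) / √n ∈ Icc (-M) M := by
    rw [mem_Icc, ← abs_le]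
    by_contra! h
    exact hgy.ne' (hM _ h)
  refine le_trans ?_ ((hu _ hyM).trans ?_)
  · rw [Finset.sum_filter]
    refine Finset.sum_le_sum fun f _ => ?_
    have hf := iid_nonneg hQ (blockLength P Q b n) f
    split_ifs with h1 h2 h2
    · exact le_rfl
    · rcases hf.eq_or_lt with h0 | h0
      · simp [← h0]
      · refine absurd ?_ h2
        have := Real.log_le_log h0 h1
        gcongr
    · exact mul_nonneg hf (hg0 _)
    · simp
  · rw [Finset.sum_filter]
    refine Finset.sum_le_sum fun f _ => ?_
    have hf := iid_nonneg hP n f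
    split_ifs with h1 h2 h2
    · simp
    · rcases hf.eq_or_lt with h0 | h0
      · simp [← h0]
      · refine absurd ?_ h2
        rw [← sub_div, div_le_div_iff_of_pos_right hn'] at h1
        rw [← Real.log_le_log_iff h0 (by positivity), Real.log_mul (Real.exp_pos _).ne' hy.ne',
          Real.log_exp]
        linarith
    · simpa using hf
    · simp

end Achievability

section Threshold
open Topology Set

lemma setIntegral_Ioi_pos {F : ℝ → ℝ} (hF : Integrable F) {z : ℝ} (h : ∀ x, z < x → 0 < F x) :
    0 < ∫ x in Ioi z, F x := by
  rw [setIntegral_pos_iff_support_of_nonneg_ae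
    (ae_restrict_of_forall_mem measurableSet_Ioi fun x hx => (h x hx).le) hF.integrableOn]
  rw [inter_eq_right.2 (show Ioi z ⊆ Function.support F from fun x hx => (h x hx).ne')]
  simp

/-- Positive densities `p` and `q` such that the square root `φ` of `p / q` is symmetric around
`x₀`, decreases to the left of `x₀`, increases to the right of `x₀`, and is unbounded. -/
structure IsValleyRatio (p q φ : ℝ → ℝ) (x₀ : ℝ) : Prop where
  integrable_left : Integrable p
  integrable_right : Integrable q
  right_pos : ∀ x, 0 < q x
  continuous_right : Continuous q
  continuous_ratio : Continuous φ
  ratio_pos : ∀ x, 0 < φ x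
  eq_mul : ∀ x, p x = φ x ^ 2 * q x
  ratio_lt_iff : ∀ x y, φ x < φ y ↔ |x - x₀| < |y - x₀|
  tendsto_ratio : Tendsto φ atBot atTop

namespace IsValleyRatio

variable {p q φ : ℝ → ℝ} {x₀ t : ℝ}

lemma left_pos (h : IsValleyRatio p q φ x₀) (x : ℝ) : 0 < p x := by
  rw [h.eq_mul]
  have := h.ratio_pos x
  have := h.right_pos x
  positivity

lemma ratio_le (h : IsValleyRatio p q φ x₀) {x y : ℝ} (hxy : |x - x₀| ≤ |y - x₀|) : φ x ≤ φ y :=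
  not_lt.1 fun hlt => hxy.not_gt ((h.ratio_lt_iff y x).1 hlt)

lemma sq_ratio_mul_tail_lt (h : IsValleyRatio p q φ x₀) (ht : x₀ ≤ t) :
    φ t ^ 2 * ∫ x in Ioi t, q x < ∫ x in Ioi t, p x := by
  rw [← sub_pos, ← integral_const_mul, ← integral_sub h.integrable_left.integrableOn
    (h.integrable_right.integrableOn.const_mul _)]
  refine setIntegral_Ioi_pos (h.integrable_left.sub (h.integrable_right.const_mul _)) fun x hx => ?_
  rw [Pi.sub_apply, h.eq_mul, ← sub_mul]
  refine mul_pos (sub_pos.2 (pow_lt_pow_left₀ ((h.ratio_lt_iff _ _).2 ?_) (h.ratio_pos t).le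
    two_ne_zero)) (h.right_pos x)
  rw [abs_of_nonneg (by linarith), abs_of_nonneg (by linarith)]
  linarith

lemma exists_threshold (h : IsValleyRatio p q φ x₀) :
    ∃ t, φ t ^ 2 * ∫ x in Ioi t, q x = ∫ x in Ioi t, p x := by
  have hc : Continuous fun t => φ t ^ 2 * (∫ x in Ioi t, q x) - ∫ x in Ioi t, p x :=
    ((h.continuous_ratio.pow 2).mul (continuous_integral_Ioi h.integrable_right)).sub
      (continuous_integral_Ioi h.integrable_left)
  have hT : 0 < ∫ x in Ioi x₀, q x :=
    setIntegral_Ioi_pos h.integrable_right fun x _ => h.right_pos x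
  have hlim := ((tendsto_pow_atTop two_ne_zero).comp h.tendsto_ratio).atTop_mul_const hT
  obtain ⟨y, hy, hyx⟩ := ((hlim.eventually_ge_atTop (∫ x, p x)).and
    (eventually_le_atBot x₀)).exists
  have hy0 : 0 ≤ φ y ^ 2 * (∫ x in Ioi y, q x) - ∫ x in Ioi y, p x := by
    have h1 : ∫ x in Ioi y, p x ≤ ∫ x, p x :=
      setIntegral_le_integral h.integrable_left (.of_forall fun x => (h.left_pos x).le)
    have h2 : ∫ x in Ioi x₀, q x ≤ ∫ x in Ioi y, q x :=
      setIntegral_mono_set h.integrable_right.integrableOn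
        (.of_forall fun x => (h.right_pos x).le) (Ioi_subset_Ioi hyx).eventuallyLE
    have h3 := mul_le_mul_of_nonneg_left h2 (sq_nonneg (φ y))
    simp only [Function.comp_apply] at hy
    linarith
  obtain ⟨t, -, ht⟩ := intermediate_value_Icc' hyx hc.continuousOn
    ⟨(sub_neg.2 (h.sq_ratio_mul_tail_lt le_rfl)).le, hy0⟩
  exact ⟨t, sub_eq_zero.1 ht⟩

lemma threshold_lt (h : IsValleyRatio p q φ x₀)
    (ht : φ t ^ 2 * ∫ x in Ioi t, q x = ∫ x in Ioi t, p x) : t < x₀ := by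
  by_contra! hx
  exact (h.sq_ratio_mul_tail_lt hx).ne ht

lemma antitone_ratio_min (h : IsValleyRatio p q φ x₀) (ht : t ≤ x₀) :
    Antitone fun x => φ (min x t) := fun x y hxy => by
  refine h.ratio_le ?_
  have := min_le_right x t
  have := min_le_right y t
  have := min_le_min_right t hxy
  rw [abs_of_nonpos (by linarith), abs_of_nonpos (by linarith)]
  linarith

lemma ratio_min_ge (h : IsValleyRatio p q φ x₀) (ht : t ≤ x₀) (x : ℝ) :
    φ t ≤ φ (min x t) := by
  have := h.antitone_ratio_min ht (le_max_left x t)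
  simpa using this

lemma integrable_sq_ratio_min (h : IsValleyRatio p q φ x₀) :
    Integrable fun x => φ (min x t) ^ 2 * q x := by
  have hc := h.continuous_ratio
  have hq := h.continuous_right
  refine (h.integrable_left.add (h.integrable_right.const_mul (φ t ^ 2))).mono'
    (by fun_prop) (.of_forall fun x => ?_)
  have hp := h.left_pos x
  have hq := h.right_pos x
  rw [Real.norm_of_nonneg (by positivity), Pi.add_apply, h.eq_mul]
  rcases min_choice x t with hm | hm <;> rw [hm]
  · have : 0 ≤ φ t ^ 2 * q x := by positivity
    linarith
  · have : 0 ≤ φ x ^ 2 * q x := by positivity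
    linarith

lemma integrable_ratio_min (h : IsValleyRatio p q φ x₀) :
    Integrable fun x => φ (min x t) * q x := by
  have hc := h.continuous_ratio
  have hq := h.continuous_right
  refine ((h.integrable_sq_ratio_min (t := t)).add h.integrable_right).mono'
    (by fun_prop) (.of_forall fun x => ?_)
  have hq := h.right_pos x
  have := h.ratio_pos (min x t)
  rw [Real.norm_of_nonneg (by positivity), Pi.add_apply]
  nlinarith [sq_nonneg (φ (min x t) - 1)]

lemma integrable_div_ratio_min (h : IsValleyRatio p q φ x₀) (ht : t ≤ x₀) :
    Integrable fun x => p x * (φ (min x t))⁻¹ := by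
  have hc := h.continuous_ratio
  refine h.integrable_left.mul_bdd (c := (φ t)⁻¹) (Continuous.aestronglyMeasurable
    (Continuous.inv₀ (by fun_prop) fun x => (h.ratio_pos _).ne')) (.of_forall fun x => ?_)
  rw [Real.norm_of_nonneg (inv_pos.2 (h.ratio_pos _)).le]
  exact inv_anti₀ (h.ratio_pos t) (h.ratio_min_ge ht x)

lemma setIntegral_Iic_sqrt_add (h : IsValleyRatio p q φ x₀)
    (ht : φ t ^ 2 * ∫ x in Ioi t, q x = ∫ x in Ioi t, p x) :
    (∫ x in Iic t, √(p x * q x)) + √((∫ x in Ioi t, p x) * ∫ x in Ioi t, q x) =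
      ∫ x, φ (min x t) * q x := by
  have hi := h.integrable_ratio_min (t := t)
  have hT : 0 ≤ ∫ x in Ioi t, q x :=
    setIntegral_nonneg measurableSet_Ioi fun x _ => (h.right_pos x).le
  rw [← intervalIntegral.integral_Iic_add_Ioi (b := t) hi.integrableOn hi.integrableOn]
  congr 1
  · refine setIntegral_congr_fun measurableSet_Iic fun x hx => ?_
    simp only [min_eq_left (mem_Iic.1 hx), h.eq_mul]
    rw [mul_assoc, ← sq, ← mul_pow, Real.sqrt_sq (mul_pos (h.ratio_pos x) (h.right_pos x)).le]
  · rw [← ht, mul_assoc, ← sq, ← mul_pow, Real.sqrt_sq (mul_nonneg (h.ratio_pos t).le hT),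
      ← integral_const_mul]
    refine setIntegral_congr_fun measurableSet_Ioi fun x hx => ?_
    simp only [min_eq_right (le_of_lt (mem_Ioi.1 hx))]

lemma integral_div_ratio_min (h : IsValleyRatio p q φ x₀)
    (ht : φ t ^ 2 * ∫ x in Ioi t, q x = ∫ x in Ioi t, p x) :
    ∫ x, p x * (φ (min x t))⁻¹ = ∫ x, φ (min x t) * q x := by
  have hi := h.integrable_ratio_min (t := t)
  have hi' := h.integrable_div_ratio_min (h.threshold_lt ht).le
  have hφ := (h.ratio_pos t).ne'
  rw [← intervalIntegral.integral_Iic_add_Ioi (b := t) hi.integrableOn hi.integrableOn,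
    ← intervalIntegral.integral_Iic_add_Ioi (b := t) hi'.integrableOn hi'.integrableOn]
  congr 1
  · refine setIntegral_congr_fun measurableSet_Iic fun x hx => ?_
    have hφ := (h.ratio_pos x).ne'
    simp only [min_eq_left (mem_Iic.1 hx), h.eq_mul]
    field_simp
  · have h1 : ∫ x in Ioi t, p x * (φ (min x t))⁻¹ = (∫ x in Ioi t, p x) * (φ t)⁻¹ := by
      rw [← integral_mul_const]
      refine setIntegral_congr_fun measurableSet_Ioi fun x hx => ?_
      simp only [min_eq_right (le_of_lt (mem_Ioi.1 hx))]
    have h2 : ∫ x in Ioi t, φ (min x t) * q x = φ t * ∫ x in Ioi t, q x := by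
      rw [← integral_const_mul]
      refine setIntegral_congr_fun measurableSet_Ioi fun x hx => ?_
      simp only [min_eq_right (le_of_lt (mem_Ioi.1 hx))]
    rw [h1, h2, ← ht]
    field_simp

/-- The density that equals `p` left of the threshold and is proportional to `q` right of it has
smaller tails than `p`. -/
lemma tail_le (h : IsValleyRatio p q φ x₀)
    (ht : φ t ^ 2 * ∫ x in Ioi t, q x = ∫ x in Ioi t, p x) (z : ℝ) :
    ∫ x in Ioi z, φ (min x t) ^ 2 * q x ≤ ∫ x in Ioi z, p x := by
  have htx := h.threshold_lt ht
  have hD : Integrable fun x => p x - φ t ^ 2 * q x :=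
    h.integrable_left.sub (h.integrable_right.const_mul _)
  have hright : ∀ z, t ≤ z → ∫ x in Ioi z, φ (min x t) ^ 2 * q x = φ t ^ 2 * ∫ x in Ioi z, q x :=
    fun z hz => by
      rw [← integral_const_mul]
      refine setIntegral_congr_fun measurableSet_Ioi fun x hx => ?_
      rw [min_eq_right (hz.trans (le_of_lt hx))]
  have hsub : ∀ z, ∫ x in Ioi z, (p x - φ t ^ 2 * q x) =
      (∫ x in Ioi z, p x) - φ t ^ 2 * ∫ x in Ioi z, q x := fun z => by
    rw [integral_sub h.integrable_left.integrableOn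
      (h.integrable_right.integrableOn.const_mul _), integral_const_mul]
  rcases le_or_gt t z with hz | hz
  · rw [hright z hz, ← sub_nonneg, ← hsub]
    rcases le_or_gt z (2 * x₀ - t) with hz' | hz'
    · have h1 := intervalIntegral.integral_Ioi_sub_Ioi hD.integrableOn hz
      rw [hsub t, ht, sub_self] at h1
      have h2 : ∫ x in t..z, (p x - φ t ^ 2 * q x) ≤ 0 := by
        rw [intervalIntegral.integral_of_le hz]
        refine setIntegral_nonpos measurableSet_Ioc fun x hx => ?_
        rw [h.eq_mul, ← sub_mul]
        refine mul_nonpos_of_nonpos_of_nonneg (sub_nonpos.2 (pow_le_pow_left₀ (h.ratio_pos x).le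
          (h.ratio_le ?_) 2)) (h.right_pos x).le
        rw [abs_of_nonpos (show t - x₀ ≤ 0 by linarith), abs_le]
        constructor <;> linarith [hx.1, hx.2]
      linarith
    · refine setIntegral_nonneg measurableSet_Ioi fun x hx => ?_
      have hx : z < x := hx
      rw [h.eq_mul, ← sub_mul]
      refine mul_nonneg (sub_nonneg.2 (pow_le_pow_left₀ (h.ratio_pos t).le (h.ratio_le ?_) 2))
        (h.right_pos x).le
      rw [abs_of_nonpos (by linarith), abs_of_nonneg (by linarith)]
      linarith
  · have hi := h.integrable_sq_ratio_min (t := t)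
    rw [← intervalIntegral.integral_interval_add_Ioi (a := z) (b := t) hi.integrableOn
      hi.integrableOn, hright t le_rfl, ht,
      ← intervalIntegral.integral_interval_add_Ioi (a := z) (b := t)
      h.integrable_left.integrableOn h.integrable_left.integrableOn]
    refine le_of_eq (congrArg (· + _) (intervalIntegral.integral_congr fun x hx => ?_))
    rw [uIcc_of_le hz.le] at hx
    simp only [min_eq_left hx.2, h.eq_mul]

end IsValleyRatio
end Threshold

section Shift
open Topology Set

namespace IsValleyRatio

variable {p q φ : ℝ → ℝ} {x₀ t : ℝ}

lemma integrable_ratio_min_shift (h : IsValleyRatio p q φ x₀) (ht : t ≤ x₀) {d : ℝ} (hd : 0 ≤ d) :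
    Integrable fun x => φ (min (x + d) t) * q x := by
  have hc := h.continuous_ratio
  have hq := h.continuous_right
  refine (h.integrable_ratio_min (t := t)).mono' (by fun_prop) (.of_forall fun x => ?_)
  have hq := h.right_pos x
  have := h.ratio_pos (min (x + d) t)
  rw [Real.norm_of_nonneg (by positivity)]
  exact mul_le_mul_of_nonneg_right (h.antitone_ratio_min ht (by linarith)) hq.le

lemma integral_ratio_min_shift_lt (h : IsValleyRatio p q φ x₀) (ht : t ≤ x₀) {d : ℝ}
    (hd : 0 < d) : ∫ x, φ (min (x + d) t) * q x < ∫ x, φ (min x t) * q x := by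
  have hc := h.continuous_ratio
  have hq := h.continuous_right
  have hi := h.integrable_ratio_min (t := t)
  have hi' := h.integrable_ratio_min_shift ht hd.le
  rw [← sub_pos, ← integral_sub hi hi']
  refine integral_pos_of_integrable_nonneg_nonzero (x := t - d) (by fun_prop) (hi.sub hi')
    (fun x => ?_) ?_
  · exact sub_nonneg.2 (mul_le_mul_of_nonneg_right (h.antitone_ratio_min ht (by linarith))
      (h.right_pos x).le)
  · rw [← sub_mul, sub_add_cancel, min_self, min_eq_left (by linarith)]
    refine mul_ne_zero (sub_ne_zero.2 (ne_of_gt ((h.ratio_lt_iff _ _).2 ?_))) (h.right_pos _).ne'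
    rw [abs_of_nonpos (by linarith), abs_of_nonpos (by linarith)]
    linarith

end IsValleyRatio

lemma exists_isValleyRatio_normalPDF {v w : ℝ} (hv : 0 < v) (hvw : v < w) (m : ℝ) :
    ∃ φ x₀, IsValleyRatio (normalPDF 0 w) (normalPDF m v) φ x₀ := by
  have hw := hv.trans hvw
  set A : ℝ := (w - v) / (4 * v * w) with hA
  have hA0 : 0 < A := div_pos (by linarith) (by positivity)
  set x₀ : ℝ := m * w / (w - v) with hx₀
  set K : ℝ := √(√(v / w) * Real.exp (m ^ 2 / (2 * v) - 2 * A * x₀ ^ 2)) with hK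
  have hK0 : 0 < K := by positivity
  refine ⟨fun x => K * Real.exp (A * (x - x₀) ^ 2), x₀, integrable_normalPDF _ hw,
    integrable_normalPDF _ hv, normalPDF_pos hv, continuous_normalPDF _ _, by fun_prop,
    fun x => by positivity, fun x => ?_, fun x y => ?_, ?_⟩
  · have h1 : (√(2 * Real.pi * w))⁻¹ = √(v / w) * (√(2 * Real.pi * v))⁻¹ := by
      rw [← Real.sqrt_inv, ← Real.sqrt_inv, ← Real.sqrt_mul (by positivity)]
      congr 1
      field_simp
    have hwv : w - v ≠ 0 := by linarith
    have h2 : -(x - 0) ^ 2 / (2 * w) = m ^ 2 / (2 * v) - 2 * A * x₀ ^ 2 +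
        2 * (A * (x - x₀) ^ 2) + -(x - m) ^ 2 / (2 * v) := by
      rw [hA, hx₀]
      field_simp
      ring
    rw [mul_pow, hK, Real.sq_sqrt (by positivity), normalPDF, normalPDF, h1, h2, Real.exp_add,
      Real.exp_add, two_mul (A * (x - x₀) ^ 2), Real.exp_add]
    ring
  · rw [mul_lt_mul_iff_right₀ hK0, Real.exp_lt_exp, mul_lt_mul_iff_right₀ hA0, sq_lt_sq]
  · refine (Real.tendsto_exp_atTop.comp (Tendsto.const_mul_atTop hA0 ?_)).const_mul_atTop hK0
    have : Tendsto (fun x : ℝ => x - x₀) atBot atBot := tendsto_atBot_add_const_right _ _ tendsto_id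
    simpa [sq] using this.atBot_mul_atBot₀ this

lemma stdG_div_sqrt {v : ℝ} (hv : 0 < v) (m x : ℝ) :
    stdG ((x - m) / √v) = ∫ t in Iic x, normalPDF m v t := by
  have hs : 0 < √v := by positivity
  have h1 : ∀ t, normalPDF m v t = (√v)⁻¹ * normalPDF 0 1 ((t - m) / √v) := fun t => by
    have := Real.sq_sqrt hv.le
    rw [normalPDF, normalPDF, Real.sqrt_mul (by positivity), mul_inv, mul_one, mul_one, sub_zero,
      div_pow, this, neg_div, neg_div, div_div, mul_comm v 2]
    ring
  have h2 := Measure.integral_comp_div ((Iic ((x - m) / √v)).indicator (normalPDF 0 1)) √v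
  rw [integral_indicator measurableSet_Iic, abs_of_pos hs, smul_eq_mul,
    ← integral_sub_right_eq_self _ m] at h2
  rw [stdG, ← mul_right_inj' hs.ne', ← h2, ← integral_const_mul,
    ← integral_indicator measurableSet_Iic]
  refine integral_congr_ae (.of_forall fun t => ?_)
  by_cases ht : t ≤ x
  · simp [indicator, ht, h1, div_le_div_iff_of_pos_right hs, hs.ne']
  · simp [indicator, ht, div_le_div_iff_of_pos_right hs]

lemma one_sub_stdG_div_sqrt {v : ℝ} (hv : 0 < v) (m x : ℝ) :
    1 - stdG ((x - m) / √v) = ∫ t in Ioi x, normalPDF m v t := by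
  have hi := integrable_normalPDF m hv
  rw [stdG_div_sqrt hv, ← integral_normalPDF m hv,
    ← intervalIntegral.integral_Iic_add_Ioi (b := x) hi.integrableOn hi.integrableOn]
  ring

lemma normalPDF_sub (m v d x : ℝ) : normalPDF (m - d) v x = normalPDF m v (x + d) := by
  simp only [normalPDF]
  ring_nf

end Shift

section Limit
open Topology Set

variable [Fintype α] [Fintype β] {P : α → ℝ} {Q : β → ℝ}

lemma integrable_sqrt_mul {F G : ℝ → ℝ} (hFc : Continuous F) (hGc : Continuous G)
    (hF0 : ∀ x, 0 ≤ F x) (hG0 : ∀ x, 0 ≤ G x) (hF : Integrable F) (hG : Integrable G) :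
    Integrable fun x => √(F x * G x) := by
  refine ((hF.add hG).div_const 2).mono' (by fun_prop) (.of_forall fun x => ?_)
  rw [Real.norm_of_nonneg (Real.sqrt_nonneg _)]
  exact sqrt_mul_le_half_add (hF0 x) (hG0 x)

/-- Achievability bound for an arbitrary continuous density whose tails are dominated by those of
the source. -/
lemma eventually_lt_FD_of_tail_le (hP : IsProb P) (hVP : 0 < V P) (hQ : IsProb Q) (hVQ : 0 < V Q)
    (b : ℝ) {a : ℝ → ℝ} (hac : Continuous a) (ha0 : ∀ x, 0 ≤ a x) (hai : Integrable a)
    (htail : ∀ z, ∫ x in Ioi z, a x ≤ ∫ x in Ioi z, NP P x) {θ : ℝ}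
    (hθ : θ < ∫ x, √(a x * NPQ P Q b x)) :
    ∀ᶠ n : ℕ in atTop, θ < FD (iid P n) (iid Q (blockLength P Q b n)) := by
  have hHP := H_pos hP hVP
  have hHQ := H_pos hQ hVQ
  have hv : 0 < H P / H Q * V Q := by positivity
  have hq : ∀ x, 0 < NPQ P Q b x := normalPDF_pos hv
  have hqc : Continuous (NPQ P Q b) := continuous_normalPDF _ _
  have hsi := integrable_sqrt_mul hac hqc ha0 (fun x => (hq x).le) hai (integrable_normalPDF _ hv)
  set c : ℕ → ℝ := fun n => 1 - ((n : ℝ) + 1)⁻¹ with hc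
  have hc0 : ∀ n, 0 ≤ c n := fun n =>
    sub_nonneg.2 (inv_le_one_of_one_le₀ (by linarith [n.cast_nonneg (α := ℝ)]))
  have hc1 : ∀ n, c n < 1 := fun n => sub_lt_self _ (by positivity)
  have hclim : Tendsto c atTop (𝓝 1) := by
    simpa [hc, one_div] using
      tendsto_const_nhds.sub (tendsto_one_div_add_atTop_nhds_zero_nat (𝕜 := ℝ))
  set r : ℕ → ℝ → ℝ := fun n x => c n * ramp 0 1 (n - |x|) with hr
  have hr0 : ∀ n x, 0 ≤ r n x := fun n x => mul_nonneg (hc0 n) (ramp_nonneg _ _ _)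
  have hrc : ∀ n x, r n x ≤ c n := fun n x => mul_le_of_le_one_right (hc0 n) (ramp_le_one _ _ _)
  have hrcont : ∀ n, Continuous (r n) := fun n => by
    simp only [hr]
    fun_prop
  have hrlim : ∀ x, Tendsto (fun n => r n x) atTop (𝓝 1) := fun x => by
    refine hclim.congr' ?_
    filter_upwards [tendsto_natCast_atTop_atTop.eventually_ge_atTop (|x| + 1)] with n hn
    have := ite_le_ramp (a := 0) one_pos (n - |x|)
    rw [if_pos (by linarith)] at this
    simp only [hr]
    rw [le_antisymm (ramp_le_one _ _ _) this, mul_one]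
  have hlim : Tendsto (fun n => ∫ x, √(r n x) * √(a x * NPQ P Q b x)) atTop
      (𝓝 (∫ x, √(a x * NPQ P Q b x))) := by
    refine tendsto_integral_of_dominated_convergence _ (fun n => ?_) hsi (fun n => ?_) ?_
    · have := hrcont n
      exact Continuous.aestronglyMeasurable (by fun_prop)
    · refine .of_forall fun x => ?_
      rw [Real.norm_of_nonneg (by positivity)]
      exact mul_le_of_le_one_left (Real.sqrt_nonneg _)
        (Real.sqrt_le_one.2 ((hrc n x).trans (hc1 n).le))
    · refine .of_forall fun x => ?_
      simpa using (hrlim x).sqrt.mul_const (√(a x * NPQ P Q b x))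
  obtain ⟨n, hn⟩ := (hlim.eventually_const_lt hθ).exists
  have hrn := hrcont n
  refine eventually_lt_FD hP hVP hQ hVQ b (g := fun x => r n x * a x / NPQ P Q b x) (M := n)
    (by fun_prop (disch := exact fun x => (hq x).ne')) (fun x => ?_) (fun x hx => ?_) (fun z => ?_)
    (hn.trans_eq ?_)
  · exact div_nonneg (mul_nonneg (hr0 n x) (ha0 x)) (hq x).le
  · have : r n x = 0 := by
      have := ramp_le_ite (a := 0) one_pos (n - |x|)
      rw [if_neg (by linarith)] at this
      simp [hr, le_antisymm this (ramp_nonneg _ _ _)]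
    simp [this]
  · have hT : 0 < ∫ x in Ioi z, NP P x :=
      setIntegral_Ioi_pos (integrable_normalPDF _ hVP) fun x _ => normalPDF_pos hVP x
    calc ∫ x in Ioi z, NPQ P Q b x * (r n x * a x / NPQ P Q b x)
        = ∫ x in Ioi z, r n x * a x := by
          refine integral_congr_ae (.of_forall fun x => ?_)
          have := (hq x).ne'
          field_simp
      _ ≤ ∫ x in Ioi z, c n * a x := by
          refine integral_mono_of_nonneg (.of_forall fun x => mul_nonneg (hr0 n x) (ha0 x))
            (hai.integrableOn.const_mul _)
            (.of_forall fun x => mul_le_mul_of_nonneg_right (hrc n x) (ha0 x))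
      _ = c n * ∫ x in Ioi z, a x := integral_const_mul _ _
      _ ≤ c n * ∫ x in Ioi z, NP P x := mul_le_mul_of_nonneg_left (htail z) (hc0 n)
      _ < ∫ x in Ioi z, NP P x := mul_lt_of_lt_one_left hT (hc1 n)
  · refine integral_congr_ae (.of_forall fun x => ?_)
    have hqx := hq x
    dsimp only
    rw [mul_div_assoc, Real.sqrt_mul (hr0 n x), mul_left_comm]
    congr 1
    have : a x * NPQ P Q b x = NPQ P Q b x ^ 2 * (a x / NPQ P Q b x) := by
      field_simp
    rw [this, Real.sqrt_mul (by positivity), Real.sqrt_sq hqx.le]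

lemma NPQ_shift (P : α → ℝ) (Q : β → ℝ) (b b' x : ℝ) :
    NPQ P Q b' (x + H Q * (b' - b)) = NPQ P Q b x := by
  rw [NPQ, ← normalPDF_sub, NPQ]
  ring_nf

variable {φ : ℝ → ℝ} {x₀ t b : ℝ}

lemma eventually_FD_lt_of_threshold (hP : IsProb P) (hVP : 0 < V P) (hQ : IsProb Q)
    (hVQ : 0 < V Q) (h : IsValleyRatio (NP P) (NPQ P Q b) φ x₀)
    (ht : φ t ^ 2 * ∫ x in Ioi t, NPQ P Q b x = ∫ x in Ioi t, NP P x) {b' : ℝ} (hb : b ≤ b')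
    {θ : ℝ} (hθ : (∫ x, φ (min x t) * NPQ P Q b x) / 2 +
      (∫ x, φ (min (x + H Q * (b' - b)) t) * NPQ P Q b x) / 2 < θ) :
    ∀ᶠ n : ℕ in atTop, FD (iid P n) (iid Q (blockLength P Q b' n)) < θ := by
  have hHQ := H_pos hQ hVQ
  have htx := (h.threshold_lt ht).le
  set d := H Q * (b' - b) with hd
  have hd0 : 0 ≤ d := mul_nonneg hHQ.le (by linarith)
  obtain ⟨κ, hκ, hκθ⟩ : ∃ κ > 0, (∫ x, φ (min x t) * NPQ P Q b x) / 2 + κ / 2 +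
      (∫ x, φ (min (x + d) t) * NPQ P Q b x) / 2 < θ := by
    refine ⟨θ - ((∫ x, φ (min x t) * NPQ P Q b x) / 2 +
      (∫ x, φ (min (x + d) t) * NPQ P Q b x) / 2), by linarith, by linarith⟩
  have hφc := h.continuous_ratio
  have hφ0 := h.ratio_pos
  have hsc : Continuous fun x => max (φ (min x t))⁻¹ κ :=
    (Continuous.inv₀ (by fun_prop) fun x => (hφ0 _).ne').max continuous_const
  have hp0 : ∀ x, 0 < NP P x := normalPDF_pos hVP
  have hpi := h.integrable_left
  have hsC : ∀ x, max (φ (min x t))⁻¹ κ ≤ max (φ t)⁻¹ κ := fun x =>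
    max_le_max (inv_anti₀ (hφ0 t) (h.ratio_min_ge htx x)) le_rfl
  have hs0 : ∀ x, 0 < max (φ (min x t))⁻¹ κ := fun x => lt_max_of_lt_right hκ
  refine eventually_FD_lt hP hVP hQ hVQ b' hsc (fun x y hxy => ?_) hκ (fun x => le_max_right _ _)
    hsC (lt_of_le_of_lt ?_ hκθ)
  · exact max_le_max (inv_anti₀ (hφ0 _) (h.antitone_ratio_min htx hxy)) le_rfl
  · have h1 : ∫ x, NP P x * max (φ (min x t))⁻¹ κ ≤ (∫ x, φ (min x t) * NPQ P Q b x) + κ := by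
      rw [← h.integral_div_ratio_min ht]
      have h2 : κ = ∫ x, NP P x * κ := by
        rw [integral_mul_const]
        simp only [NP]
        rw [integral_normalPDF _ hVP, one_mul]
      nth_rw 2 [h2]
      rw [← integral_add (h.integrable_div_ratio_min htx) (hpi.mul_const _)]
      refine integral_mono_of_nonneg (.of_forall fun x => (mul_pos (hp0 x) (hs0 x)).le)
        ((h.integrable_div_ratio_min htx).add (hpi.mul_const _)) (.of_forall fun x => ?_)
      dsimp only
      rw [← mul_add]
      refine mul_le_mul_of_nonneg_left (max_le ?_ ?_) (hp0 x).le
      · linarith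
      · linarith [inv_pos.2 (hφ0 (min x t))]
    have h2 : ∫ x, NPQ P Q b' x * (max (φ (min x t))⁻¹ κ)⁻¹ ≤
        ∫ x, φ (min (x + d) t) * NPQ P Q b x := by
      rw [← integral_add_right_eq_self _ d]
      refine integral_mono_of_nonneg (.of_forall fun x => ?_)
        (h.integrable_ratio_min_shift htx hd0) (.of_forall fun x => ?_)
      · dsimp only
        rw [hd, NPQ_shift]
        exact mul_nonneg (h.right_pos x).le (inv_pos.2 (hs0 _)).le
      · dsimp only
        rw [hd, NPQ_shift, ← hd, mul_comm]
        refine mul_le_mul_of_nonneg_right ?_ (h.right_pos x).le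
        exact inv_le_of_inv_le₀ (hφ0 _) (le_max_left _ _)
    linarith

lemma tendsto_FD_of_threshold (hP : IsProb P) (hVP : 0 < V P) (hQ : IsProb Q)
    (hVQ : 0 < V Q) (h : IsValleyRatio (NP P) (NPQ P Q b) φ x₀)
    (ht : φ t ^ 2 * ∫ x in Ioi t, NPQ P Q b x = ∫ x in Ioi t, NP P x) :
    Tendsto (fun n : ℕ => FD (iid P n) (iid Q (blockLength P Q b n))) atTop
      (𝓝 (∫ x, φ (min x t) * NPQ P Q b x)) := by
  refine tendsto_order.2 ⟨fun θ hθ => ?_, fun θ hθ => ?_⟩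
  · have hφc := h.continuous_ratio
    have hqc := h.continuous_right
    refine eventually_lt_FD_of_tail_le hP hVP hQ hVQ b (a := fun x => φ (min x t) ^ 2 * NPQ P Q b x)
      (by fun_prop) (fun x => mul_nonneg (sq_nonneg _) (h.right_pos x).le)
      h.integrable_sq_ratio_min (h.tail_le ht) (hθ.trans_eq ?_)
    refine integral_congr_ae (.of_forall fun x => ?_)
    dsimp only
    rw [mul_assoc, ← sq, ← mul_pow, Real.sqrt_sq (mul_pos (h.ratio_pos _) (h.right_pos x)).le]
  · refine eventually_FD_lt_of_threshold hP hVP hQ hVQ h ht le_rfl ?_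
    simpa using hθ

lemma exists_isValleyRatio_NP_NPQ (hP : IsProb P) (hVP : 0 < V P) (hQ : IsProb Q) (hVQ : 0 < V Q)
    (hratio : H P / V P < H Q / V Q) (b : ℝ) :
    ∃ φ x₀, IsValleyRatio (NP P) (NPQ P Q b) φ x₀ := by
  have hHP := H_pos hP hVP
  have hHQ := H_pos hQ hVQ
  refine exists_isValleyRatio_normalPDF (by positivity) ?_ (H Q * b)
  rw [div_lt_div_iff₀ hVP hVQ] at hratio
  rw [div_mul_eq_mul_div, div_lt_iff₀ hHQ]
  linarith

/-- The limiting fidelity strictly decreases in the second order rate. -/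
lemma exists_tendsto_FD_lt (hP : IsProb P) (hVP : 0 < V P) (hQ : IsProb Q) (hVQ : 0 < V Q)
    (hratio : H P / V P < H Q / V Q) :
    ∃ F : ℝ → ℝ, StrictAnti F ∧ ∀ b,
      Tendsto (fun n : ℕ => FD (iid P n) (iid Q (blockLength P Q b n))) atTop (𝓝 (F b)) := by
  have hHQ := H_pos hQ hVQ
  choose φ x₀ h using exists_isValleyRatio_NP_NPQ hP hVP hQ hVQ hratio
  choose t ht using fun b => (h b).exists_threshold
  have hlim := fun b => tendsto_FD_of_threshold hP hVP hQ hVQ (h b) (ht b)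
  refine ⟨_, fun b b' hb => ?_, hlim⟩
  have hlt := (h b).integral_ratio_min_shift_lt ((h b).threshold_lt (ht b)).le
    (mul_pos hHQ (sub_pos.2 hb))
  obtain ⟨θ, hθ1, hθ2⟩ := exists_between (show
    (∫ x, φ b (min x (t b)) * NPQ P Q b x) / 2 +
      (∫ x, φ b (min (x + H Q * (b' - b)) (t b)) * NPQ P Q b x) / 2 <
      ∫ x, φ b (min x (t b)) * NPQ P Q b x by linarith)
  refine (le_of_tendsto (hlim b') ?_).trans_lt hθ2
  exact (eventually_FD_lt_of_threshold hP hVP hQ hVQ (h b) (ht b) hb.le hθ1).mono fun n => le_of_lt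

end Limit

section Rate
open Topology Set

variable [Fintype α] [Fintype β] {P : α → ℝ} {Q : β → ℝ}

lemma tendsto_FD_of_NP_div_NPQ_eq (hP : IsProb P) (hVP : 0 < V P) (hQ : IsProb Q) (hVQ : 0 < V Q)
    (hratio : H P / V P < H Q / V Q) {b t : ℝ}
    (ht : NP P t / NPQ P Q b t = (1 - GP P t) / (1 - GPQ P Q b t)) :
    Tendsto (fun n : ℕ => FD (iid P n) (iid Q (blockLength P Q b n))) atTop
      (𝓝 (IPQ P Q b t + √((1 - GP P t) * (1 - GPQ P Q b t)))) := by
  have hHP := H_pos hP hVP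
  have hHQ := H_pos hQ hVQ
  have hv : 0 < H P / H Q * V Q := by positivity
  obtain ⟨φ, x₀, h⟩ := exists_isValleyRatio_NP_NPQ hP hVP hQ hVQ hratio b
  have hGP : 1 - GP P t = ∫ x in Ioi t, NP P x := by
    have := one_sub_stdG_div_sqrt hVP 0 t
    rwa [sub_zero] at this
  have hGPQ : 1 - GPQ P Q b t = ∫ x in Ioi t, NPQ P Q b x := by
    have := one_sub_stdG_div_sqrt hv (H Q * b) t
    rw [div_eq_inv_mul, ← Real.sqrt_inv, show (H P / H Q * V Q)⁻¹ = H Q / (H P * V Q) by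
      field_simp] at this
    exact this
  have hT : 0 < ∫ x in Ioi t, NPQ P Q b x :=
    setIntegral_Ioi_pos h.integrable_right fun x _ => h.right_pos x
  have hq := h.right_pos t
  rw [hGP, hGPQ, h.eq_mul, mul_div_cancel_right₀ _ hq.ne', eq_div_iff hT.ne'] at ht
  rw [IPQ, hGP, hGPQ, h.setIntegral_Iic_sqrt_add ht]
  exact tendsto_FD_of_threshold hP hVP hQ hVQ h ht

lemma LD_bounds (hP : IsProb P) (hQ : IsProb Q) {ν : ℝ} {n L M : ℕ}
    (hL : ν ≤ FD (iid P n) (iid Q L)) (hM : FD (iid P n) (iid Q M) < ν) :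
    L ≤ LD P Q ν n ∧ LD P Q ν n ≤ M := by
  have hle : ∀ K ∈ {K : ℕ | ν ≤ FD (iid P n) (iid Q K)}, K ≤ M := fun K hK => by
    by_contra! hlt
    exact ((show ν ≤ _ from hK).trans (FD_iid_antitone (isProb_iid hP n) hQ hlt.le)).not_gt hM
  exact ⟨le_csSup ⟨M, hle⟩ hL, csSup_le ⟨L, hL⟩ hle⟩

end Rate

/-- second order expansion of `L^D_n(P,Q|ν)` when
`H(P)/V(P) < H(Q)/V(Q)`; here `β` is the threshold for `b` and `F_2(b) = ν`. -/
theorem second_order_rate_case_lt {X Y : Type*} [Fintype X] [Fintype Y]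
    (P : X → ℝ) (Q : Y → ℝ) (hP : IsProb P) (hQ : IsProb Q)
    (hVP : 0 < V P) (hVQ : 0 < V Q)
    (hratio : H P / V P < H Q / V Q)
    (ν : ℝ) (hν : 0 < ν ∧ ν < 1) (b β : ℝ)
    (hβ : NP P β / NPQ P Q b β = (1 - GP P β) / (1 - GPQ P Q b β))
    (hb : IPQ P Q b β + Real.sqrt ((1 - GP P β) * (1 - GPQ P Q b β)) = ν) :
    Tendsto (fun n : ℕ =>
        ((LD P Q ν n : ℝ) - H P / H Q * n) / Real.sqrt n) atTop (nhds b) ∧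
    RD2 P Q ν = b := by
  have hHP := H_pos hP hVP
  have hHQ := H_pos hQ hVQ
  obtain ⟨F, hF, hlim⟩ := exists_tendsto_FD_lt hP hVP hQ hVQ hratio
  have hFb : F b = ν := hb ▸ tendsto_nhds_unique (hlim b)
    (tendsto_FD_of_NP_div_NPQ_eq hP hVP hQ hVQ hratio hβ)
  refine ⟨tendsto_order.2 ⟨fun a ha => ?_, fun a ha => ?_⟩, ?_⟩
  · obtain ⟨c, hac, hcb⟩ := exists_between ha
    filter_upwards [(hlim c).eventually_const_lt (hFb ▸ hF hcb),
      (hlim (b + 1)).eventually_lt_const (hFb ▸ hF (lt_add_one b)),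
      (tendsto_sub_div_sqrt_blockLength hHP hHQ c).eventually_const_lt hac] with n h1 h2 h3
    have := (LD_bounds hP hQ h1.le h2).1
    refine h3.trans_le ?_
    gcongr
  · obtain ⟨c, hbc, hca⟩ := exists_between ha
    filter_upwards [(hlim (b - 1)).eventually_const_lt (hFb ▸ hF (sub_one_lt b)),
      (hlim c).eventually_lt_const (hFb ▸ hF hbc),
      (tendsto_sub_div_sqrt_blockLength hHP hHQ c).eventually_lt_const hca] with n h1 h2 h3
    have := (LD_bounds hP hQ h1.le h2).2
    refine lt_of_le_of_lt ?_ h3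
    gcongr
  · refine IsGreatest.csSup_eq ⟨⟨ν, le_rfl, hFb ▸ hlim b⟩, ?_⟩
    rintro c ⟨r, hr, hc⟩
    rw [tendsto_nhds_unique hc (hlim c), ← hFb] at hr
    exact hF.le_iff_ge.1 hr

end RNG
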